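/- arXiv:2506.09165 — 4 statements merged into one kernel-verified Lean document; each statement's English description precedes it below -/
import Mathlib

section
/- Suppose d ≥ 3 and μ = ∑_{k=1}^m π_k (μ_{k1} × ⋯ × μ_{kd}) is a mixture of product measures such that, for every j ∈ {1,…,d}, the probability measures μ_{1j}, …, μ_{mj} are linearly independent in the real vector space of finite signed Borel measures on ℝ. Then μ is identifiable. -/
open MeasureTheory

/-- The mixture of product measures `∑ k, π k • (μ k 1 × ⋯ × μ k d)` on `ℝ^d`. -/
noncomputable def mixtureOfProducts {m d : ℕ}
    (π : Fin m → ℝ) (μ : Fin m → Fin d → ProbabilityMeasure ℝ) :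
    Measure (Fin d → ℝ) :=
  ∑ k, ENNReal.ofReal (π k) • Measure.pi (fun j => (μ k j : Measure ℝ))

/-- Identifiability of the mixture representation `(π, μ)`: any other representation
of the same joint measure agrees with it up to a permutation of the components. -/
def IsIdentifiable {m d : ℕ}
    (π : Fin m → ℝ) (μ : Fin m → Fin d → ProbabilityMeasure ℝ) : Prop :=
  ∀ (π' : Fin m → ℝ) (μ' : Fin m → Fin d → ProbabilityMeasure ℝ),
    (∀ k, 0 < π' k) → (∑ k, π' k = 1) →
    mixtureOfProducts π' μ' = mixtureOfProducts π μ →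
    ∃ σ : Equiv.Perm (Fin m), ∀ k : Fin m,
      π k = π' (σ k) ∧ ∀ j : Fin d, μ k j = μ' (σ k) j

/-- A finite linearly independent family in a vector space has a dual family of functionals. -/
lemma LinearIndependent.exists_dual_family {ι V : Type*} [Fintype ι] [DecidableEq ι]
    [AddCommGroup V] [Module ℝ V] {v : ι → V} (hv : LinearIndependent ℝ v) :
    ∃ φ : ι → V →ₗ[ℝ] ℝ, ∀ i k, φ i (v k) = if i = k then 1 else 0 := by
  classical
  refine ⟨fun i => (Module.Basis.extend hv.linearIndepOn_id).coord
    ⟨v i, hv.linearIndepOn_id.subset_extend _ ⟨i, rfl⟩⟩, fun i k => ?_⟩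
  have hk : v k = Module.Basis.extend hv.linearIndepOn_id
      ⟨v k, hv.linearIndepOn_id.subset_extend _ ⟨k, rfl⟩⟩ := by simp
  rw [hk, Module.Basis.coord_apply, Module.Basis.repr_self, Finsupp.single_apply]
  simp [hv.injective.eq_iff, eq_comm]

/-- An identity between sums of products of functions persists when linear functionals are
applied to the factors. -/
lemma sum_mul_apply_apply_congr {ι X Y : Type*} [Fintype ι]
    {p q : ι → ℝ} {f f' : ι → X → ℝ} {g g' : ι → Y → ℝ}
    (h : ∀ x y, ∑ k, p k * (f k x * g k y) = ∑ k, q k * (f' k x * g' k y))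
    (φ : (X → ℝ) →ₗ[ℝ] ℝ) (ψ : (Y → ℝ) →ₗ[ℝ] ℝ) :
    ∑ k, p k * (φ (f k) * ψ (g k)) = ∑ k, q k * (φ (f' k) * ψ (g' k)) := by
  have hφ : ∀ y, ∑ k, p k * (φ (f k) * g k y) = ∑ k, q k * (φ (f' k) * g' k y) := by
    intro y
    have hy : ∑ k, (p k * g k y) • f k = ∑ k, (q k * g' k y) • f' k := by
      ext x
      simpa [Finset.sum_apply, mul_assoc, mul_comm, mul_left_comm] using h x y
    simpa [map_sum, mul_assoc, mul_comm, mul_left_comm] using congrArg φ hy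
  have hg : ∑ k, (p k * φ (f k)) • g k = ∑ k, (q k * φ (f' k)) • g' k := by
    ext y
    simpa [Finset.sum_apply, mul_assoc] using hφ y
  simpa [map_sum, mul_assoc] using congrArg ψ hg

/-- Uniqueness of the third factors in a sum of products of three functions, when the
factors on one side are linearly independent. -/
lemma exists_perm_third_factor_eq {ι X Y Z : Type*} [Fintype ι]
    {p q : ι → ℝ} {f f' : ι → X → ℝ} {g g' : ι → Y → ℝ} {h h' : ι → Z → ℝ}
    (hp : ∀ k, p k ≠ 0) (hf : LinearIndependent ℝ f) (hg : LinearIndependent ℝ g)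
    (hh : LinearIndependent ℝ h)
    (h₂ : ∀ x y, ∑ k, p k * (f k x * g k y) = ∑ k, q k * (f' k x * g' k y))
    (h₃ : ∀ x y z, ∑ k, p k * (f k x * g k y * h k z) =
      ∑ k, q k * (f' k x * g' k y * h' k z)) :
    ∃ σ : Equiv.Perm ι, ∀ k, h k = h' (σ k) := by
  classical
  obtain ⟨φ, hφ⟩ := hf.exists_dual_family
  obtain ⟨ψ, hψ⟩ := hg.exists_dual_family
  let P : Matrix ι ι ℝ := Matrix.of fun i l => (p i)⁻¹ * (q l * φ i (f' l))
  let Q : Matrix ι ι ℝ := Matrix.of fun l i => ψ i (g' l)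
  have hdiag : ∀ w w' : ι → ℝ, (∀ x y, ∑ k, p k * w k * (f k x * g k y) =
      ∑ k, q k * w' k * (f' k x * g' k y)) →
      P * Matrix.diagonal w' * Q = Matrix.diagonal w := by
    intro w w' hw
    ext i j
    have hij := sum_mul_apply_apply_congr hw (φ i) (ψ j)
    have hsum : (P * Matrix.diagonal w' * Q) i j =
        (p i)⁻¹ * ∑ l, q l * w' l * (φ i (f' l) * ψ j (g' l)) := by
      rw [Matrix.mul_apply, Finset.mul_sum]
      refine Finset.sum_congr rfl fun l _ => ?_
      simp only [Matrix.mul_diagonal, P, Q, Matrix.of_apply]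
      ring
    rw [hsum, ← hij, Matrix.diagonal_apply]
    by_cases h : i = j
    · subst h
      simp [hφ, hψ, hp]
    · simp [hφ, hψ, h]
  have hPQ : P * Q = 1 := by
    simpa using hdiag 1 1 (by simpa using h₂)
  have hQP : Q * P = 1 := mul_eq_one_comm.mp hPQ
  have hentry : ∀ l i z, Q l i * h i z = h' l z * Q l i := by
    intro l i z
    have hcomm : Q * Matrix.diagonal (fun i => h i z) =
        Matrix.diagonal (fun l => h' l z) * Q := by
      rw [← hdiag (fun i => h i z) (fun l => h' l z) fun x y => by
        simpa only [mul_assoc, mul_comm, mul_left_comm] using h₃ x y z, ← mul_assoc, ← mul_assoc, hQP, one_mul]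
    simpa [Matrix.mul_diagonal, Matrix.diagonal_mul] using congrFun (congrFun hcomm l) i
  have hne : ∀ i, ∃ l, Q l i ≠ 0 := by
    intro i
    by_contra! hzero
    have := congrFun (congrFun hPQ i) i
    simp [Matrix.mul_apply, hzero] at this
  choose s hs using hne
  have hhs : ∀ i, h i = h' (s i) := fun i => funext fun z =>
    mul_left_cancel₀ (hs i) ((hentry (s i) i z).trans (mul_comm _ _))
  have hinj : Function.Injective s := fun i j hij =>
    hh.injective (by rw [hhs i, hhs j, hij])
  exact ⟨Equiv.ofBijective s (Finite.injective_iff_bijective.mp hinj), hhs⟩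

/-- Linear independence of finite measures as signed measures gives linear independence of
their values on measurable sets. -/
lemma linearIndependent_real_of_toSignedMeasure {ι α : Type*} [Fintype ι] [MeasurableSpace α]
    {ν : ι → Measure α} [∀ k, IsFiniteMeasure (ν k)]
    (hν : LinearIndependent ℝ fun k => (ν k).toSignedMeasure) :
    LinearIndependent ℝ fun k (s : {s : Set α // MeasurableSet s}) => (ν k).real s := by
  rw [Fintype.linearIndependent_iff] at hν ⊢
  refine fun c hc => hν c ?_
  ext s hs
  have h := congrFun hc ⟨s, hs⟩
  simp only [Finset.sum_apply, Pi.smul_apply, smul_eq_mul, Pi.zero_apply] at h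
  rw [← FunLike.coeAddMonoidHom_apply, map_sum]
  simpa [Finset.sum_apply, Measure.toSignedMeasure_apply_measurable hs] using h

lemma mixtureOfProducts_real_pi {m d : ℕ} {π : Fin m → ℝ} (hπ : ∀ k, 0 ≤ π k)
    (μ : Fin m → Fin d → ProbabilityMeasure ℝ) (A : Fin d → Set ℝ) :
    (mixtureOfProducts π μ).real (Set.univ.pi A) =
      ∑ k, π k * ∏ j, (μ k j : Measure ℝ).real (A j) := by
  simp only [mixtureOfProducts, Measure.real, Measure.coe_finsetSum, Finset.sum_apply,
    Measure.smul_apply, smul_eq_mul, Measure.pi_pi]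
  rw [ENNReal.toReal_sum fun k _ => ENNReal.mul_ne_top ENNReal.ofReal_ne_top
    (ENNReal.prod_ne_top fun j _ => measure_ne_top _ _)]
  simp [ENNReal.toReal_mul, ENNReal.toReal_prod, ENNReal.toReal_ofReal (hπ _)]

lemma prod_update_eq_mul_prod_erase {ι X : Type*} [Fintype ι] [DecidableEq ι]
    (F : ι → X → ℝ) (A : ι → X) (c : ι) (x : X) :
    ∏ j, F j (Function.update A c x j) = F c x * ∏ j ∈ Finset.univ.erase c, F j (A j) := by
  rw [← Finset.mul_prod_erase _ _ (Finset.mem_univ c), Function.update_self]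
  congr 1
  exact Finset.prod_congr rfl fun j hj => by
    rw [Function.update_of_ne (Finset.ne_of_mem_erase hj)]

/-- Uniqueness of the components of a mixture of products of normalized functions. -/
lemma exists_perm_of_sum_prod_eq {κ ι X : Type*} [Fintype κ] [Fintype ι] {p q : κ → ℝ}
    {F G : κ → ι → X → ℝ} (u : X) (hF : ∀ k j, F k j u = 1) (hG : ∀ k j, G k j u = 1)
    (hp : ∀ k, p k ≠ 0) (hli : ∀ j, LinearIndependent ℝ fun k => F k j)
    {a b c : ι} (hab : a ≠ b) (hac : a ≠ c) (hbc : b ≠ c)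
    (h : ∀ A : ι → X, ∑ k, p k * ∏ j, F k j (A j) = ∑ k, q k * ∏ j, G k j (A j)) :
    ∃ σ : Equiv.Perm κ, ∀ k, p k = q (σ k) ∧ ∀ j, F k j = G (σ k) j := by
  classical
  have hthree : ∀ H : ι → X → ℝ, (∀ j, H j u = 1) → ∀ x y z,
      ∏ j, H j (Function.update (Function.update (Function.update (fun _ => u) c z) b y) a x j) =
        H a x * H b y * H c z := by
    intro H hH x y z
    rw [← Finset.prod_subset (Finset.subset_univ {a, b, c}),
      Finset.prod_insert (by simp [hab, hac]), Finset.prod_pair hbc]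
    · simp [Function.update_of_ne hab.symm, Function.update_of_ne hac.symm,
        Function.update_of_ne hbc.symm, mul_assoc]
    · intro j _ hj
      simp only [Finset.mem_insert, Finset.mem_singleton, not_or] at hj
      simp [Function.update_of_ne hj.1, Function.update_of_ne hj.2.1,
        Function.update_of_ne hj.2.2, hH]
  have h₃ : ∀ x y z, ∑ k, p k * (F k a x * F k b y * F k c z) =
      ∑ k, q k * (G k a x * G k b y * G k c z) := by
    intro x y z
    have := h (Function.update (Function.update (Function.update (fun _ => u) c z) b y) a x)
    simpa only [hthree _ (hF _), hthree _ (hG _)] using this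
  obtain ⟨σ, hσ⟩ := exists_perm_third_factor_eq hp (hli a) (hli b) (hli c)
    (fun x y => by simpa [hF, hG] using h₃ x y u) h₃
  have hcancel : ∀ (A : ι → X) k, p k * ∏ j ∈ Finset.univ.erase c, F k j (A j) =
      q (σ k) * ∏ j ∈ Finset.univ.erase c, G (σ k) j (A j) := by
    intro A
    have hzero := Fintype.linearIndependent_iff.mp (hli c)
      (fun k => p k * ∏ j ∈ Finset.univ.erase c, F k j (A j) -
        q (σ k) * ∏ j ∈ Finset.univ.erase c, G (σ k) j (A j)) (by
        ext z
        have hz := h (Function.update A c z)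
        rw [← Equiv.sum_comp σ fun k => q k * _] at hz
        simp only [prod_update_eq_mul_prod_erase, ← hσ] at hz
        simp only [Finset.sum_apply, Pi.smul_apply, smul_eq_mul, Pi.zero_apply, sub_mul,
          Finset.sum_sub_distrib, sub_eq_zero]
        simpa only [mul_assoc, mul_comm, mul_left_comm] using hz)
    exact fun k => sub_eq_zero.mp (hzero k)
  have hweight : ∀ k, p k = q (σ k) := fun k => by
    simpa [hF, hG] using hcancel (fun _ => u) k
  refine ⟨σ, fun k => ⟨hweight k, fun j => ?_⟩⟩
  by_cases hj : j = c
  · exact hj ▸ hσ k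
  ext x
  have hsingle : ∀ H : ι → X → ℝ, (∀ i, H i u = 1) →
      ∏ i ∈ Finset.univ.erase c, H i (Function.update (fun _ => u) j x i) = H j x := by
    intro H hH
    rw [Finset.prod_eq_single_of_mem j (by simp [hj]), Function.update_self]
    intro i _ hi
    rw [Function.update_of_ne hi, hH]
  have hx := hcancel (Function.update (fun _ => u) j x) k
  rw [hsingle _ (hF k), hsingle _ (hG _), ← hweight k] at hx
  exact mul_left_cancel₀ (hp k) hx

/-- **Linear independence condition (Allman–Matias–Rhodes).** If `d ≥ 3` and for each
coordinate `j` the component measures `μ 1 j, …, μ m j` are linearly independent in the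
space of finite signed measures, then the mixture is identifiable. -/
theorem linear_independence_identifiability {m d : ℕ} (hm : 2 ≤ m) (hd : 3 ≤ d)
    (π : Fin m → ℝ) (μ : Fin m → Fin d → ProbabilityMeasure ℝ)
    (hπ : ∀ k, 0 < π k) (hπsum : ∑ k, π k = 1)
    (hli : ∀ j : Fin d,
      LinearIndependent ℝ (fun k : Fin m => ((μ k j : Measure ℝ)).toSignedMeasure)) :
    IsIdentifiable π μ := by
  intro π' μ' hπ' _ heq
  obtain ⟨σ, hσ⟩ := exists_perm_of_sum_prod_eq
    (X := {s : Set ℝ // MeasurableSet s}) (p := π) (q := π')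
    (F := fun k j s => (μ k j : Measure ℝ).real s)
    (G := fun k j s => (μ' k j : Measure ℝ).real s)
    ⟨Set.univ, MeasurableSet.univ⟩ (by simp) (by simp) (fun k => (hπ k).ne')
    (fun j => linearIndependent_real_of_toSignedMeasure (hli j))
    (a := ⟨0, by omega⟩) (b := ⟨1, by omega⟩) (c := ⟨2, by omega⟩)
    (by simp) (by simp) (by simp)
    (fun A => by
      rw [← mixtureOfProducts_real_pi (fun k => (hπ k).le),
        ← mixtureOfProducts_real_pi (fun k => (hπ' k).le), heq])
  refine ⟨σ, fun k => ⟨(hσ k).1, fun j => ?_⟩⟩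
  have hμ : (μ k j : Measure ℝ) = μ' (σ k) j := Measure.ext fun s hs =>
    (measureReal_eq_measureReal_iff (measure_ne_top _ _) (measure_ne_top _ _)).mp
      (congrFun ((hσ k).2 j) ⟨s, hs⟩)
  exact Subtype.ext hμ
end

section
/- Suppose A, B ∈ ℝ^{n×n} are real symmetric positive semidefinite matrices with no zero entries on their main diagonals, with Kruskal ranks k_A and k_B respectively. Then the Kruskal rank of the Hadamard product satisfies k_{A∘B} ≥ min{n, k_A + k_B − 1}. -/
/-- The Kruskal rank of a real matrix: the largest `k` (at most the number of columns)
such that every set of `k` columns is linearly independent. -/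
noncomputable def matKruskalRank {n p : ℕ} (M : Matrix (Fin n) (Fin p) ℝ) : ℕ :=
  sSup {k : ℕ | k ≤ p ∧ ∀ I : Finset (Fin p), I.card = k →
    LinearIndependent ℝ (fun j : I => fun i : Fin n => M i j)}

open Matrix

theorem linearIndepOn_col_of_card_le_matKruskalRank {n p : ℕ} {M : Matrix (Fin n) (Fin p) ℝ}
    {I : Finset (Fin p)} (hI : I.card ≤ matKruskalRank M) :
    LinearIndepOn ℝ M.col (I : Set (Fin p)) := by
  have hmem := Nat.sSup_mem (s := {k : ℕ | k ≤ p ∧ ∀ I : Finset (Fin p), I.card = k →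
    LinearIndependent ℝ (fun j : I => fun i : Fin n => M i j)})
    ⟨0, Nat.zero_le p, fun J hJ => by
      obtain rfl := Finset.card_eq_zero.mp hJ
      exact linearIndependent_empty_type⟩ ⟨p, fun k hk => hk.1⟩
  obtain ⟨J, hIJ, -, hJ⟩ := Finset.exists_subsuperset_card_eq (Finset.subset_univ I) hI
    (by rw [Finset.card_fin]; exact hmem.1)
  have hLI : LinearIndepOn ℝ M.col (J : Set (Fin p)) := hmem.2 J hJ
  exact hLI.mono (Finset.coe_subset.mpr hIJ)

theorem le_matKruskalRank {n p k : ℕ} {M : Matrix (Fin n) (Fin p) ℝ} (hk : k ≤ p)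
    (h : ∀ I : Finset (Fin p), I.card = k → LinearIndepOn ℝ M.col (I : Set (Fin p))) :
    k ≤ matKruskalRank M :=
  le_csSup ⟨p, fun _ hj => hj.1⟩ ⟨hk, h⟩

theorem one_le_matKruskalRank_of_diag_ne_zero {n : ℕ} {M : Matrix (Fin n) (Fin n) ℝ}
    (hn : 1 ≤ n) (hM : ∀ i, M i i ≠ 0) : 1 ≤ matKruskalRank M := by
  refine le_matKruskalRank hn fun I hI => ?_
  obtain ⟨i, rfl⟩ := Finset.card_eq_one.mp hI
  rw [Finset.coe_singleton, linearIndepOn_singleton_iff]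
  exact fun h => hM i (congrFun h i)

open scoped MatrixOrder in
theorem exists_eq_conjTranspose_mul_self_of_posSemidef {ι : Type*} [Fintype ι] [DecidableEq ι]
    {A : Matrix ι ι ℝ} (hA : A.PosSemidef) : ∃ X : Matrix ι ι ℝ, A = Xᴴ * X :=
  CStarAlgebra.nonneg_iff_eq_star_mul_self.mp hA.nonneg

/-- The quadratic form of `A ∘ B` at `c` is a squared Frobenius norm. -/
theorem mul_diagonal_mul_eq_zero_of_hadamard_mulVec_eq_zero {ι : Type*} [Fintype ι]
    [DecidableEq ι] {A B : Matrix ι ι ℝ} (hA : A.PosSemidef) (hB : B.PosSemidef) {c : ι → ℝ}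
    (hc : (A ⊙ B) *ᵥ c = 0) : A * diagonal c * B = 0 := by
  obtain ⟨X, rfl⟩ := exists_eq_conjTranspose_mul_self_of_posSemidef hA
  obtain ⟨Y, rfl⟩ := exists_eq_conjTranspose_mul_self_of_posSemidef hB
  have htrace := dotProduct_vecMul_hadamard (Xᴴ * X) (Yᴴ * Y) c c
  rw [← dotProduct_mulVec, hc, dotProduct_zero] at htrace
  have hZ : X * diagonal c * Yᴴ = 0 := by
    rw [← trace_conjTranspose_mul_self_eq_zero_iff, htrace]
    simp only [conjTranspose_eq_transpose_of_trivial, transpose_mul, transpose_transpose,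
      diagonal_transpose, Matrix.mul_assoc]
    rw [trace_mul_comm]
    simp only [Matrix.mul_assoc]
  calc Xᴴ * X * diagonal c * (Yᴴ * Y) = Xᴴ * (X * diagonal c * Yᴴ) * Y := by
        simp only [Matrix.mul_assoc]
    _ = 0 := by rw [hZ, Matrix.mul_zero, Matrix.zero_mul]

/-- Dual functional separating one column from finitely many others. -/
theorem exists_vecMul_separating {m ι : Type*} [Fintype m] [DecidableEq m] {M : Matrix m ι ℝ}
    {s : Set ι} (hs : LinearIndepOn ℝ M.col s) {j : ι} (hj : j ∈ s) :
    ∃ w : m → ℝ, (w ᵥ* M) j ≠ 0 ∧ ∀ i ∈ s, i ≠ j → (w ᵥ* M) i = 0 := by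
  obtain ⟨f, hfj, hf⟩ := Submodule.exists_le_ker_of_notMem (hs.notMem_span hj)
  have hfM : ∀ i, ((fun k => f fun l => if k = l then 1 else 0) ᵥ* M) i = f (M.col i) := fun i => by
    rw [LinearMap.pi_apply_eq_sum_univ f (M.col i)]
    simp [vecMul, dotProduct, mul_comm]
  refine ⟨fun k => f fun l => if k = l then 1 else 0, by rwa [hfM], fun i hi hij => ?_⟩
  rw [hfM]
  exact hf (Submodule.subset_span ⟨i, ⟨hi, hij⟩, rfl⟩)

theorem eq_zero_of_mul_diagonal_mul_eq_zero {n : ℕ} {A B : Matrix (Fin n) (Fin n) ℝ}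
    (hB : B.IsHermitian) {T U : Finset (Fin n)} {j : Fin n} (hjT : j ∈ T) (hjU : j ∈ U)
    (hT : LinearIndepOn ℝ A.col (T : Set (Fin n))) (hU : LinearIndepOn ℝ B.col (U : Set (Fin n)))
    {c : Fin n → ℝ} (hc : ∀ i, i ∉ T → i ∉ U → c i = 0) (hT' : ∀ i ∈ T, i ∈ U → i = j)
    (h : A * diagonal c * B = 0) : c j = 0 := by
  obtain ⟨w, hwj, hw⟩ := exists_vecMul_separating hU (Finset.mem_coe.mpr hjU)
  rw [← mulVec_transpose, ← conjTranspose_eq_transpose_of_trivial, hB.eq] at hwj hw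
  have hsum : ∑ i ∈ T, (c i * (B *ᵥ w) i) • A.col i = 0 := by
    have h0 : (A * diagonal c * B) *ᵥ w = 0 := by rw [h, zero_mulVec]
    rw [← mulVec_mulVec, ← mulVec_mulVec] at h0
    rw [← h0, Finset.sum_subset (Finset.subset_univ T)]
    · ext k
      simp [mulVec, dotProduct, diagonal_apply, Finset.sum_apply, mul_comm]
    · intro i _ hi
      by_cases hiU : i ∈ U
      · rw [hw i hiU (by rintro rfl; exact hi hjT), mul_zero, zero_smul]
      · rw [hc i hi hiU, zero_mul, zero_smul]
  have := linearIndepOn_finset_iff.mp hT _ hsum j hjT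
  exact (mul_eq_zero.mp this).resolve_right hwj

/-- **Kruskal rank of a Hadamard product of Gram matrices.** If `A, B` are real positive
semidefinite matrices with no zero diagonal entries, then
`k_{A∘B} ≥ min {n, k_A + k_B − 1}`. -/
theorem kruskalRank_hadamard_ge {n : ℕ} (A B : Matrix (Fin n) (Fin n) ℝ)
    (hA : A.PosSemidef) (hB : B.PosSemidef)
    (hdA : ∀ i, A i i ≠ 0) (hdB : ∀ i, B i i ≠ 0) :
    min n (matKruskalRank A + matKruskalRank B - 1) ≤
      matKruskalRank (Matrix.hadamard A B) := by
  rcases Nat.eq_zero_or_pos n with rfl | hn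
  · simp
  have hkA := one_le_matKruskalRank_of_diag_ne_zero hn hdA
  have hkB := one_le_matKruskalRank_of_diag_ne_zero hn hdB
  refine le_matKruskalRank (min_le_left _ _) fun I hI => ?_
  rw [linearIndepOn_finset_iff]
  intro g hg j hj
  let c : Fin n → ℝ := fun i => if i ∈ I then g i else 0
  have hc : (A ⊙ B) *ᵥ c = 0 := by
    rw [← hg]
    ext k
    simp [c, mulVec, dotProduct, Finset.sum_apply, mul_comm]
  obtain ⟨T, hjT, hTI, hT⟩ := Finset.exists_subsuperset_card_eq
    (Finset.singleton_subset_iff.mpr hj) (n := min (matKruskalRank A) I.card)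
    (by simpa using ⟨hkA, ⟨j, hj⟩⟩) (min_le_right _ _)
  rw [Finset.singleton_subset_iff] at hjT
  have hU : (insert j (I \ T)).card ≤ matKruskalRank B := by
    have h1 := Finset.card_insert_le j (I \ T)
    have h2 := Finset.card_sdiff_add_card_eq_card hTI
    omega
  have hcj : c j = 0 := eq_zero_of_mul_diagonal_mul_eq_zero hB.isHermitian hjT
    (Finset.mem_insert_self j (I \ T))
    (linearIndepOn_col_of_card_le_matKruskalRank (hT.trans_le (min_le_left _ _)))
    (linearIndepOn_col_of_card_le_matKruskalRank hU)
    (fun i hiT hiU => if_neg fun hiI => hiU (by simp [hiI, hiT]))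
    (fun i hiT hiU => by simpa [hiT] using hiU)
    (mul_diagonal_mul_eq_zero_of_hadamard_mulVec_eq_zero hA hB hc)
  simpa [c, hj] using hcj
end

section
/- Let H₁, H₂, H₃ be real Hilbert spaces, and let x = (x₁,…,x_m) ∈ H₁^m, y = (y₁,…,y_m) ∈ H₂^m, z = (z₁,…,z_m) ∈ H₃^m have Kruskal ranks k_x, k_y, k_z with k_x + k_y + k_z ≥ 2m + 2. If a = (a₁,…,a_m) ∈ H₁^m, b = (b₁,…,b_m) ∈ H₂^m, c = (c₁,…,c_m) ∈ H₃^m satisfy ∑_{k=1}^m x_k ⊗ y_k ⊗ z_k = ∑_{k=1}^m a_k ⊗ b_k ⊗ c_k in the tensor product H₁ ⊗ H₂ ⊗ H₃ over ℝ, then there exist a permutation σ of {1,…,m} and real scalars D_x(k), D_y(k), D_z(k) with D_x(k)·D_y(k)·D_z(k) = 1 for all k, such that a_{σ(k)} = D_x(k) x_k, b_{σ(k)} = D_y(k) y_k and c_{σ(k)} = D_z(k) z_k for all k ∈ {1,…,m}. -/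
open scoped TensorProduct

/-- The Kruskal rank of a finite family of vectors: the largest `k ≤ m` such that every
subfamily of cardinality `k` is linearly independent. -/
noncomputable def famKruskalRank {E : Type*} [AddCommGroup E] [Module ℝ E] {m : ℕ}
    (v : Fin m → E) : ℕ :=
  sSup {k : ℕ | k ≤ m ∧ ∀ I : Finset (Fin m), I.card = k →
    LinearIndependent ℝ (fun i : I => v i)}

open Module Submodule

section FamSpan

variable {ι K U V W : Type*} [Field K] [AddCommGroup U] [Module K U] [AddCommGroup V] [Module K V]
  [AddCommGroup W] [Module K W]

/-- The span of the vectors of a family indexed by a finite set. -/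
def famSpan (K : Type*) {ι V : Type*} [Field K] [AddCommGroup V] [Module K V]
    (v : ι → V) (S : Finset ι) : Submodule K V :=
  span K (v '' (S : Set ι))

instance famSpan_finiteDimensional (v : ι → V) (S : Finset ι) :
    FiniteDimensional K (famSpan K v S) :=
  FiniteDimensional.span_of_finite K (S.finite_toSet.image v)

theorem mem_famSpan (v : ι → V) {S : Finset ι} {i : ι} (hi : i ∈ S) : v i ∈ famSpan K v S :=
  subset_span ⟨i, hi, rfl⟩

theorem famSpan_le {v : ι → V} {S : Finset ι} {P : Submodule K V} :
    famSpan K v S ≤ P ↔ ∀ i ∈ S, v i ∈ P := by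
  simp [famSpan, span_le, Set.subset_def]

theorem famSpan_mono (v : ι → V) {S T : Finset ι} (h : S ⊆ T) : famSpan K v S ≤ famSpan K v T :=
  famSpan_le.2 fun _ hi => mem_famSpan v (h hi)

theorem famSpan_union [DecidableEq ι] (v : ι → V) (S T : Finset ι) :
    famSpan K v (S ∪ T) = famSpan K v S ⊔ famSpan K v T := by
  simp [famSpan, Set.image_union, span_union]

theorem famSpan_empty (v : ι → V) : famSpan K v ∅ = ⊥ := by
  simp [famSpan]

theorem famSpan_singleton (v : ι → V) (i : ι) : famSpan K v {i} = span K {v i} := by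
  simp [famSpan]

theorem sum_smul_mem_famSpan (v : ι → V) (S : Finset ι) (c : ι → K) :
    ∑ i ∈ S, c i • v i ∈ famSpan K v S :=
  sum_mem fun _ hi => smul_mem _ _ (mem_famSpan v hi)

theorem mem_famSpan_iff {v : ι → V} {S : Finset ι} {w : V} :
    w ∈ famSpan K v S ↔ ∃ c : ι → K, ∑ i ∈ S, c i • v i = w := by
  refine ⟨fun h => ?_, fun ⟨c, hc⟩ => hc ▸ sum_smul_mem_famSpan v S c⟩
  rw [famSpan, Finsupp.mem_span_image_iff_linearCombination] at h
  obtain ⟨l, hl, rfl⟩ := h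
  refine ⟨l, ?_⟩
  rw [Finsupp.linearCombination_apply, Finsupp.sum_of_support_subset l
    (by simpa [Finsupp.mem_supported] using hl) _ (by simp)]

theorem finrank_famSpan_le_card (v : ι → V) (S : Finset ι) :
    finrank K (famSpan K v S) ≤ S.card := by
  classical
  rw [famSpan, ← Finset.coe_image]
  exact (finrank_span_finset_le_card _).trans Finset.card_image_le

theorem finrank_famSpan_mono (v : ι → V) {S T : Finset ι} (h : S ⊆ T) :
    finrank K (famSpan K v S) ≤ finrank K (famSpan K v T) :=
  Submodule.finrank_mono (famSpan_mono v h)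

theorem finrank_famSpan_of_linearIndepOn {v : ι → V} {S : Finset ι}
    (h : LinearIndepOn K v (S : Set ι)) : finrank K (famSpan K v S) = S.card := by
  have := finrank_span_eq_card h
  rw [famSpan, Set.image_eq_range]
  simpa using this

theorem map_famSpan (f : V →ₗ[K] W) (v : ι → V) (S : Finset ι) :
    (famSpan K v S).map f = famSpan K (fun i => f (v i)) S := by
  rw [famSpan, famSpan, Submodule.map_span, Set.image_image]

/-- A sum of elementary tensors that vanishes bounds the dimensions spanned by its factors. -/
theorem finrank_famSpan_add_le_card_of_sum_tmul_eq_zero {u : ι → U} {v : ι → V} {C : Finset ι}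
    {c : ι → K} (hc : ∀ i ∈ C, c i ≠ 0) (h : ∑ i ∈ C, c i • (u i ⊗ₜ[K] v i) = 0) :
    finrank K (famSpan K u C) + finrank K (famSpan K v C) ≤ C.card := by
  classical
  obtain ⟨b, hbC, -, hsp, hli⟩ := exists_linearIndepOn_extension
    (linearIndepOn_empty K u) (Set.empty_subset (C : Set ι))
  obtain ⟨B, rfl⟩ := (C.finite_toSet.subset hbC).exists_finset_coe
  have hBC : B ⊆ C := by exact_mod_cast hbC
  have hu : finrank K (famSpan K u C) ≤ B.card :=
    (Submodule.finrank_mono (t := famSpan K u B) (span_le.2 hsp)).trans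
      (finrank_famSpan_le_card u B)
  have hv : famSpan K v C ≤ famSpan K v (C \ B) := by
    refine famSpan_le.2 fun j hj => ?_
    by_cases hjB : j ∈ B
    · obtain ⟨f, hf, hker⟩ := Submodule.exists_le_ker_of_notMem
        (linearIndepOn_iff_notMem_span.1 hli j hjB)
      have hz : ∀ i ∈ B, i ≠ j → f (u i) = 0 := fun i hi hij =>
        hker (subset_span ⟨i, ⟨hi, hij⟩, rfl⟩)
      have key := congrArg (fun w => TensorProduct.lid K V (f.rTensor V w)) h
      simp only [map_sum, map_smul, LinearMap.rTensor_tmul, TensorProduct.lid_tmul, map_zero] at key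
      rw [← Finset.sum_sdiff hBC, Finset.sum_eq_single_of_mem j hjB
        fun i hi hij => by rw [hz i hi hij, zero_smul, smul_zero], smul_smul] at key
      have hmem : (c j * f (u j)) • v j ∈ famSpan K v (C \ B) := by
        rw [eq_neg_of_add_eq_zero_right key]
        exact neg_mem (sum_mem fun i hi => smul_mem _ _ (smul_mem _ _ (mem_famSpan v hi)))
      exact (Submodule.smul_mem_iff _ (mul_ne_zero (hc j hj) hf)).1 hmem
    · exact mem_famSpan v (by simp [hj, hjB])
  have := (Submodule.finrank_mono hv).trans (finrank_famSpan_le_card v (C \ B))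
  rw [Finset.card_sdiff_of_subset hBC] at this
  have := Finset.card_le_card hBC
  omega

/-- Disjointness of spans is inherited by families of elementary tensors. -/
theorem disjoint_famSpan_tmul (u : ι → U) {v : ι → V} {S T : Finset ι}
    (h : Disjoint (famSpan K v S) (famSpan K v T)) :
    Disjoint (famSpan K (fun i => u i ⊗ₜ[K] v i) S) (famSpan K (fun i => u i ⊗ₜ[K] v i) T) := by
  obtain ⟨P, hP, hPT⟩ := h.exists_isCompl
  let p := (P.projection _ hPT).lTensor U
  have hS : famSpan K (fun i => u i ⊗ₜ[K] v i) S ≤ LinearMap.eqLocus p LinearMap.id := by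
    refine famSpan_le.2 fun i hi => ?_
    simp [p, LinearMap.mem_eqLocus,
      Submodule.projection_apply_of_mem_left hPT (hP (mem_famSpan v hi))]
  have hT : famSpan K (fun i => u i ⊗ₜ[K] v i) T ≤ LinearMap.ker p := by
    refine famSpan_le.2 fun i hi => ?_
    simp [p, Submodule.projection_apply_of_mem_right hPT (mem_famSpan v hi)]
  rw [Submodule.disjoint_def]
  intro w hwS hwT
  have h1 := hS hwS
  have h2 := hT hwT
  rw [LinearMap.mem_eqLocus] at h1
  rw [LinearMap.mem_ker] at h2
  rw [h2] at h1
  exact h1.symm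

/-- The vectors indexed by `A` cannot be separated into two nonempty parts with independent
spans. -/
def NonSplit (K : Type*) {ι V : Type*} [Field K] [AddCommGroup V] [Module K V] [DecidableEq ι]
    (v : ι → V) (A : Finset ι) : Prop :=
  ∀ S ⊂ A, S.Nonempty → ¬ Disjoint (famSpan K v S) (famSpan K v (A \ S))

theorem NonSplit.of_tmul [DecidableEq ι] {u : ι → U} {v : ι → V} {A : Finset ι}
    (h : NonSplit K (fun i => u i ⊗ₜ[K] v i) A) : NonSplit K v A :=
  fun S hSA hS hd => h S hSA hS (disjoint_famSpan_tmul u hd)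

theorem finrank_sup_le_add_finrank_map_mkQ (P Q : Submodule K V) [FiniteDimensional K P]
    [FiniteDimensional K Q] : finrank K ↥(P ⊔ Q) ≤ finrank K P + finrank K (Q.map P.mkQ) := by
  have h1 := Submodule.finrank_sup_add_finrank_inf_eq P Q
  have h2 := LinearMap.finrank_range_add_finrank_ker (P.mkQ.domRestrict Q)
  have h3 : finrank K (LinearMap.ker (P.mkQ.domRestrict Q)) ≤ finrank K ↥(P ⊓ Q) := by
    rw [LinearMap.ker_domRestrict, ker_mkQ, ← finrank_map_subtype_eq]
    refine Submodule.finrank_mono ?_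
    rintro _ ⟨w, hw, rfl⟩
    exact ⟨hw, w.2⟩
  rw [LinearMap.range_domRestrict] at h2
  omega

/-- One enlargement step in the proof of the dimension bound for nonsplit families. -/
theorem NonSplit.exists_ssuperset [DecidableEq ι] {u : ι → U} {v : ι → V} {A S : Finset ι}
    (h : NonSplit K (fun i => u i ⊗ₜ[K] v i) A) (hSA : S ⊂ A) (hS : S.Nonempty)
    (hle : finrank K (famSpan K u S) + finrank K (famSpan K v S) ≤
      finrank K (famSpan K (fun i => u i ⊗ₜ[K] v i) S) + 1) :
    ∃ T, S ⊂ T ∧ T ⊆ A ∧ finrank K (famSpan K u T) + finrank K (famSpan K v T) ≤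
      finrank K (famSpan K (fun i => u i ⊗ₜ[K] v i) T) + 1 := by
  set t : ι → U ⊗[K] V := fun i => u i ⊗ₜ[K] v i with ht
  obtain ⟨C, hCA, hmin⟩ := exists_minimal_le_of_wellFoundedLT
    (fun C : Finset ι => ¬ Disjoint (famSpan K t S) (famSpan K t C)) _ (h S hSA hS)
  have hC := hmin.prop
  have hlt : ∀ D ⊂ C, Disjoint (famSpan K t S) (famSpan K t D) := fun D hD => by
    by_contra hn
    exact hmin.not_prop_of_lt hD hn
  have hCne : C.Nonempty := by
    rw [Finset.nonempty_iff_ne_empty]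
    rintro rfl
    exact hC (by simp [famSpan_empty])
  obtain ⟨w, hwS, hwC, hw0⟩ : ∃ w ∈ famSpan K t S, w ∈ famSpan K t C ∧ w ≠ 0 := by
    rw [Submodule.disjoint_def] at hC
    push Not at hC
    exact hC
  obtain ⟨c, hcw⟩ := mem_famSpan_iff.1 hwC
  have hc : ∀ i ∈ C, c i ≠ 0 := by
    intro i hi hci
    refine hw0 (Submodule.disjoint_def.1 (hlt _ (Finset.erase_ssubset hi)) w hwS ?_)
    rw [← hcw, ← Finset.add_sum_erase _ _ hi, hci, zero_smul, zero_add]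
    exact sum_smul_mem_famSpan t _ c
  have hli : LinearIndepOn K t (C : Set ι) := by
    rw [linearIndepOn_iff_notMem_span]
    intro i hi hmem
    have hle : famSpan K t C ≤ famSpan K t (C.erase i) := by
      refine famSpan_le.2 fun j hj => ?_
      by_cases hij : j = i
      · subst hij
        simpa [famSpan] using hmem
      · exact mem_famSpan t (Finset.mem_erase.2 ⟨hij, hj⟩)
    exact hC ((hlt _ (Finset.erase_ssubset hi)).mono_right hle)
  obtain ⟨i, hi⟩ := hCne
  have hdisj : Disjoint S C :=
    Finset.disjoint_of_subset_right hCA Finset.disjoint_sdiff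
  refine ⟨S ∪ C, ?_, Finset.union_subset hSA.1 (hCA.trans Finset.sdiff_subset), ?_⟩
  · refine ⟨Finset.subset_union_left, fun hsub => ?_⟩
    exact Finset.disjoint_right.1 hdisj hi (hsub (Finset.mem_union_right _ hi))
  have hrank : finrank K (famSpan K t S) + C.card ≤ finrank K (famSpan K t (S ∪ C)) + 1 := by
    have h1 := Submodule.finrank_sup_add_finrank_inf_eq (famSpan K t S) (famSpan K t (C.erase i))
    rw [(hlt _ (Finset.erase_ssubset hi)).eq_bot, finrank_bot, ← famSpan_union,
      finrank_famSpan_of_linearIndepOn (S := C.erase i) (hli.mono (by simp)),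
      Finset.card_erase_of_mem hi] at h1
    have h2 : finrank K (famSpan K t (S ∪ C.erase i)) ≤ finrank K (famSpan K t (S ∪ C)) :=
      finrank_famSpan_mono t (Finset.union_subset_union_right (Finset.erase_subset _ _))
    omega
  have hvrank : finrank K (famSpan K v (S ∪ C)) + 1 ≤
      finrank K (famSpan K v S) + finrank K (famSpan K v C) := by
    have h1 := Submodule.finrank_sup_add_finrank_inf_eq (famSpan K v S) (famSpan K v C)
    have h2 : famSpan K v S ⊓ famSpan K v C ≠ ⊥ := fun hb =>
      hC (disjoint_famSpan_tmul u (disjoint_iff.2 hb))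
    have h3 := Submodule.one_le_finrank_iff.2 h2
    rw [famSpan_union]
    omega
  have hurank : finrank K (famSpan K u (S ∪ C)) + finrank K (famSpan K v C) ≤
      finrank K (famSpan K u S) + C.card := by
    have h1 := finrank_sup_le_add_finrank_map_mkQ (famSpan K u S) (famSpan K u C)
    rw [map_famSpan, ← famSpan_union] at h1
    have hker : famSpan K t S ≤ LinearMap.ker ((famSpan K u S).mkQ.rTensor V) := by
      refine famSpan_le.2 fun j hj => ?_
      have : (famSpan K u S).mkQ (u j) = 0 := by simpa using mem_famSpan u hj
      rw [LinearMap.mem_ker, ht, LinearMap.rTensor_tmul, this, TensorProduct.zero_tmul]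
    have h2 := hker hwS
    rw [LinearMap.mem_ker, ← hcw, map_sum] at h2
    simp only [map_smul, ht, LinearMap.rTensor_tmul] at h2
    have h3 := finrank_famSpan_add_le_card_of_sum_tmul_eq_zero hc h2
    omega
  omega

/-- Elementary tensors forming a nonsplit family span a space of dimension at least
`d₁ + d₂ - 1`, where `d₁` and `d₂` are the dimensions of the spans of the factors. -/
theorem NonSplit.finrank_add_le [DecidableEq ι] {u : ι → U} {v : ι → V} {A : Finset ι}
    (h : NonSplit K (fun i => u i ⊗ₜ[K] v i) A) :
    finrank K (famSpan K u A) + finrank K (famSpan K v A) ≤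
      finrank K (famSpan K (fun i => u i ⊗ₜ[K] v i) A) + 1 := by
  obtain rfl | ⟨i, hi⟩ := A.eq_empty_or_nonempty
  · rw [famSpan_empty, famSpan_empty, finrank_bot, finrank_bot]
    omega
  have hsingle : finrank K (famSpan K u {i}) + finrank K (famSpan K v {i}) ≤
      finrank K (famSpan K (fun i => u i ⊗ₜ[K] v i) {i}) + 1 := by
    by_cases h0 : u i ⊗ₜ[K] v i = 0
    · have := finrank_famSpan_add_le_card_of_sum_tmul_eq_zero (K := K) (u := u) (v := v)
        (C := {i}) (c := 1) (by simp) (by simp [h0])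
      rw [Finset.card_singleton] at this
      omega
    · have hu := finrank_famSpan_le_card (K := K) u {i}
      have hv := finrank_famSpan_le_card (K := K) v {i}
      rw [Finset.card_singleton] at hu hv
      have : finrank K (famSpan K (fun i => u i ⊗ₜ[K] v i) {i}) = 1 := by
        rw [famSpan_singleton]
        exact finrank_span_singleton h0
      omega
  have hfin : {S : Finset ι | S ⊆ A ∧ S.Nonempty ∧
      finrank K (famSpan K u S) + finrank K (famSpan K v S) ≤
        finrank K (famSpan K (fun i => u i ⊗ₜ[K] v i) S) + 1}.Finite :=
    A.powerset.finite_toSet.subset fun S hS => by simpa using hS.1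
  obtain ⟨S, ⟨hSA, hS, hle⟩, hmax⟩ := hfin.exists_maximal
    ⟨{i}, by simpa using hi, Finset.singleton_nonempty i, hsingle⟩
  obtain rfl | hlt := hSA.eq_or_ssubset
  · exact hle
  · obtain ⟨T, hST, hTA, hT⟩ := h.exists_ssuperset hlt hS hle
    exact absurd (hmax ⟨hTA, hS.mono hST.1, hT⟩ hST.1) hST.2

theorem NonSplit.finrank_add_add_le [DecidableEq ι] {u : ι → U} {v : ι → V} {w : ι → W}
    {A : Finset ι} (h : NonSplit K (fun i => u i ⊗ₜ[K] (v i ⊗ₜ[K] w i)) A) :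
    finrank K (famSpan K u A) + finrank K (famSpan K v A) + finrank K (famSpan K w A) ≤
      finrank K (famSpan K (fun i => u i ⊗ₜ[K] (v i ⊗ₜ[K] w i)) A) + 2 := by
  have h1 := h.finrank_add_le
  have h2 := (NonSplit.of_tmul h).finrank_add_le
  omega

theorem tmul_ne_zero_of_ne_zero {u : U} {v : V} (hu : u ≠ 0) (hv : v ≠ 0) : u ⊗ₜ[K] v ≠ 0 := by
  intro h
  have := finrank_famSpan_add_le_card_of_sum_tmul_eq_zero (K := K) (u := fun _ : Unit => u)
    (v := fun _ => v) (C := {()}) (c := 1) (by simp) (by simp [h])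
  rw [famSpan_singleton, famSpan_singleton, finrank_span_singleton hu, finrank_span_singleton hv,
    Finset.card_singleton] at this
  omega

/-- Equal nonzero elementary tensors have proportional factors. -/
theorem exists_smul_eq_of_tmul_eq_tmul {u u' : U} {v v' : V} (hu : u ≠ 0) (hv : v ≠ 0)
    (h : u ⊗ₜ[K] v = u' ⊗ₜ[K] v') : ∃ s : K, s ≠ 0 ∧ u' = s • u ∧ v' = s⁻¹ • v := by
  have hv' : v' ≠ 0 := by
    rintro rfl
    exact tmul_ne_zero_of_ne_zero hu hv (by simpa using h)
  have hu' : u' ≠ 0 := by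
    rintro rfl
    exact tmul_ne_zero_of_ne_zero hu hv (by simpa using h)
  obtain ⟨f, hf, -⟩ := Submodule.exists_le_ker_of_notMem (p := (⊥ : Submodule K V)) (v := v')
    (by simpa using hv')
  have key := congrArg (fun w => TensorProduct.rid K U (f.lTensor U w)) h
  simp only [LinearMap.lTensor_tmul, TensorProduct.rid_tmul] at key
  have hsu : u' = ((f v')⁻¹ * f v) • u := by
    rw [mul_smul, key, smul_smul, inv_mul_cancel₀ hf, one_smul]
  have hs : (f v')⁻¹ * f v ≠ 0 := fun h0 => hu' (by rw [hsu, h0, zero_smul])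
  refine ⟨_, hs, hsu, ?_⟩
  rw [eq_inv_smul_iff₀ hs]
  by_contra hne
  refine tmul_ne_zero_of_ne_zero (K := K) hu (sub_ne_zero.2 hne) ?_
  rw [TensorProduct.tmul_sub, h, ← TensorProduct.smul_tmul, ← hsu, sub_self]

/-- A family all of whose subfamilies of size at most `p` are independent spans, together with
further vectors, a space of dimension at least `min p #I`. -/
theorem min_le_finrank_famSpan_sumElim {κ : Type*} {x : ι → V} {p : ℕ}
    (hx : ∀ S : Finset ι, S.card ≤ p → LinearIndepOn K x (S : Set ι)) (a : κ → V)
    (I : Finset ι) (J : Finset κ) :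
    min p I.card ≤ finrank K (famSpan K (Sum.elim x a) (I.disjSum J)) := by
  obtain ⟨S, hSI, hS⟩ := Finset.exists_subset_card_eq (min_le_right p I.card)
  rw [← hS, ← finrank_famSpan_of_linearIndepOn (hx S (hS.trans_le (min_le_left _ _)))]
  refine Submodule.finrank_mono (famSpan_le.2 fun i hi => ?_)
  exact mem_famSpan (Sum.elim x a) (i := Sum.inl i) (by simpa using hSI hi)

/-- A family with a nontrivial linear relation spans a space of dimension less than its size. -/
theorem finrank_famSpan_lt_card {v : ι → V} {A : Finset ι} {c : ι → K} {i : ι} (hi : i ∈ A)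
    (hc : c i ≠ 0) (h : ∑ j ∈ A, c j • v j = 0) : finrank K (famSpan K v A) < A.card := by
  classical
  have hle : famSpan K v A ≤ famSpan K v (A.erase i) := by
    refine famSpan_le.2 fun j hj => ?_
    by_cases hij : j = i
    · subst hij
      rw [← Finset.add_sum_erase _ _ hi] at h
      rw [← Submodule.smul_mem_iff _ hc, eq_neg_of_add_eq_zero_left h]
      exact neg_mem (sum_smul_mem_famSpan v _ c)
    · exact mem_famSpan v (Finset.mem_erase.2 ⟨hij, hj⟩)
  exact ((Submodule.finrank_mono hle).trans (finrank_famSpan_le_card v _)).trans_lt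
    (Finset.card_erase_lt_of_mem hi)

/-- Equal sums of vectors restrict to each part of a splitting of the union of the two families. -/
theorem sum_eq_sum_of_disjoint_famSpan [DecidableEq ι] {s t : ι → V} {I J I' J' : Finset ι}
    (hI : I' ⊆ I) (hJ : J' ⊆ J) (h : ∑ i ∈ I, s i = ∑ j ∈ J, t j)
    (hd : Disjoint (famSpan K (Sum.elim s t) (I'.disjSum J'))
      (famSpan K (Sum.elim s t) ((I \ I').disjSum (J \ J')))) :
    ∑ i ∈ I', s i = ∑ j ∈ J', t j := by
  have hmem : ∀ I J : Finset ι,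
      ∑ i ∈ I, s i - ∑ j ∈ J, t j ∈ famSpan K (Sum.elim s t) (I.disjSum J) := fun I J =>
    sub_mem
      (sum_mem fun i hi => mem_famSpan (Sum.elim s t) (i := Sum.inl i) (by simpa using hi))
      (sum_mem fun j hj => mem_famSpan (Sum.elim s t) (i := Sum.inr j) (by simpa using hj))
  rw [← sub_eq_zero]
  refine Submodule.disjoint_def.1 hd _ (hmem I' J') ?_
  have := neg_mem (hmem (I \ I') (J \ J'))
  rw [← Finset.sum_sdiff hI, ← Finset.sum_sdiff hJ] at h
  convert this using 1
  rw [← sub_eq_zero] at h ⊢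
  rw [← h]
  abel

/-- Kruskal's theorem for subfamilies: equal sums of elementary tensors have the same terms. -/
theorem exists_bijOn_of_sum_tmul_eq [DecidableEq ι] {x a : ι → U} {y b : ι → V} {z c : ι → W}
    {n p q r : ℕ} (hp : p ≤ n) (hq : q ≤ n) (hr : r ≤ n) (hn : 2 * n + 2 ≤ p + q + r)
    (hx : ∀ S : Finset ι, S.card ≤ p → LinearIndepOn K x (S : Set ι))
    (hy : ∀ S : Finset ι, S.card ≤ q → LinearIndepOn K y (S : Set ι))
    (hz : ∀ S : Finset ι, S.card ≤ r → LinearIndepOn K z (S : Set ι))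
    (I J : Finset ι) (hI : I.card ≤ n) (hJI : J.card ≤ I.card)
    (h : ∑ i ∈ I, x i ⊗ₜ[K] (y i ⊗ₜ[K] z i) = ∑ j ∈ J, a j ⊗ₜ[K] (b j ⊗ₜ[K] c j)) :
    ∃ σ : ι → ι, Set.BijOn σ I J ∧
      ∀ i ∈ I, x i ⊗ₜ[K] (y i ⊗ₜ[K] z i) = a (σ i) ⊗ₜ[K] (b (σ i) ⊗ₜ[K] c (σ i)) := by
  induction hN : I.card + J.card using Nat.strong_induction_on generalizing I J with
  | _ N ih =>
  obtain hI0 | hI1 | hI2 : I.card = 0 ∨ I.card = 1 ∨ 2 ≤ I.card := by omega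
  · have hJ0 : J.card = 0 := by omega
    rw [Finset.card_eq_zero] at hI0 hJ0
    subst hI0 hJ0
    exact ⟨id, by simp, by simp⟩
  · obtain ⟨i, rfl⟩ := Finset.card_eq_one.1 hI1
    have hne : x i ⊗ₜ[K] (y i ⊗ₜ[K] z i) ≠ 0 :=
      tmul_ne_zero_of_ne_zero ((hx {i} (by simp; omega)).ne_zero (by simp))
        (tmul_ne_zero_of_ne_zero ((hy {i} (by simp; omega)).ne_zero (by simp))
          ((hz {i} (by simp; omega)).ne_zero (by simp)))
    obtain hJ0 | hJ1 : J.card = 0 ∨ J.card = 1 := by omega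
    · rw [Finset.card_eq_zero] at hJ0
      subst hJ0
      simp [hne] at h
    · obtain ⟨j, rfl⟩ := Finset.card_eq_one.1 hJ1
      exact ⟨fun _ => j, by simp [Set.BijOn, Set.MapsTo, Set.SurjOn], by simpa using h⟩
  set s : ι → U ⊗[K] (V ⊗[K] W) := fun i => x i ⊗ₜ[K] (y i ⊗ₜ[K] z i)
  set t : ι → U ⊗[K] (V ⊗[K] W) := fun j => a j ⊗ₜ[K] (b j ⊗ₜ[K] c j)
  have hst : Sum.elim s t = fun k =>
      Sum.elim x a k ⊗ₜ[K] (Sum.elim y b k ⊗ₜ[K] Sum.elim z c k) := by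
    ext (i | j) <;> rfl
  have hsplit : ¬ NonSplit K (Sum.elim s t) (I.disjSum J) := by
    intro hns
    rw [hst] at hns
    have hdim := hns.finrank_add_add_le
    have hxI := min_le_finrank_famSpan_sumElim hx a I J
    have hyI := min_le_finrank_famSpan_sumElim hy b I J
    have hzI := min_le_finrank_famSpan_sumElim hz c I J
    obtain ⟨i, hi⟩ : I.Nonempty := Finset.card_pos.1 (by omega)
    have hlt := finrank_famSpan_lt_card (K := K) (v := Sum.elim s t) (A := I.disjSum J)
      (c := Sum.elim 1 (-1)) (i := Sum.inl i) (by simpa using hi) (by simp)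
      (by simpa [Finset.sum_disjSum, ← sub_eq_add_neg, sub_eq_zero] using h)
    rw [hst, Finset.card_disjSum] at hlt
    omega
  obtain ⟨I', J', hI', hJ', hpos, hlt, hcard, hd⟩ : ∃ I' J' : Finset ι, I' ⊆ I ∧ J' ⊆ J ∧
      0 < I'.card + J'.card ∧ I'.card + J'.card < I.card + J.card ∧ J'.card ≤ I'.card ∧
      Disjoint (famSpan K (Sum.elim s t) (I'.disjSum J'))
        (famSpan K (Sum.elim s t) ((I \ I').disjSum (J \ J'))) := by
    unfold NonSplit at hsplit
    push Not at hsplit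
    obtain ⟨S, hS, hSne, hd⟩ := hsplit
    obtain ⟨I', J', rfl⟩ : ∃ I' J' : Finset ι, S = I'.disjSum J' :=
      ⟨S.toLeft, S.toRight, Finset.toLeft_disjSum_toRight.symm⟩
    have hI' : I' ⊆ I := fun i hi => by
      simpa using hS.1 (Finset.inl_mem_disjSum.2 hi)
    have hJ' : J' ⊆ J := fun j hj => by
      simpa using hS.1 (Finset.inr_mem_disjSum.2 hj)
    have hsd : I.disjSum J \ I'.disjSum J' = (I \ I').disjSum (J \ J') := by
      ext (i | j) <;> simp
    rw [hsd] at hd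
    have hpos := Finset.card_pos.2 hSne
    have hlt := Finset.card_lt_card hS
    rw [Finset.card_disjSum] at hpos hlt
    rw [Finset.card_disjSum] at hlt
    by_cases hle : J'.card ≤ I'.card
    · exact ⟨I', J', hI', hJ', hpos, hlt, hle, hd⟩
    · have hI1 := Finset.card_le_card hI'
      have hJ1 := Finset.card_le_card hJ'
      refine ⟨I \ I', J \ J', Finset.sdiff_subset, Finset.sdiff_subset, ?_, ?_, ?_, ?_⟩
      · rw [Finset.card_sdiff_of_subset hI', Finset.card_sdiff_of_subset hJ']
        omega
      · rw [Finset.card_sdiff_of_subset hI', Finset.card_sdiff_of_subset hJ']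
        omega
      · rw [Finset.card_sdiff_of_subset hI', Finset.card_sdiff_of_subset hJ']
        omega
      · rw [Finset.sdiff_sdiff_eq_self hI', Finset.sdiff_sdiff_eq_self hJ']
        exact hd.symm
  have hI1 := Finset.card_le_card hI'
  have hJ1 := Finset.card_le_card hJ'
  have hsum := sum_eq_sum_of_disjoint_famSpan hI' hJ' h hd
  have hsum' : ∑ i ∈ I \ I', s i = ∑ j ∈ J \ J', t j := by
    rw [← Finset.sum_sdiff hI', ← Finset.sum_sdiff hJ', hsum] at h
    exact add_right_cancel h
  obtain ⟨σ, hσ, hσe⟩ := ih _ (by omega) I' J' (by omega) hcard hsum rfl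
  have hcard' : I'.card = J'.card := by
    rw [← Finset.card_image_of_injOn hσ.injOn]
    congr 1
    exact_mod_cast hσ.image_eq
  have hIc := Finset.card_sdiff_of_subset hI'
  have hJc := Finset.card_sdiff_of_subset hJ'
  obtain ⟨τ, hτ, hτe⟩ := ih _ (by omega) (I \ I') (J \ J') (by omega) (by omega) hsum' rfl
  refine ⟨I'.piecewise σ τ, ?_, fun i hi => ?_⟩
  · have h1 : Set.BijOn (I'.piecewise σ τ) I' J' :=
      hσ.congr fun i hi => (Finset.piecewise_eq_of_mem _ _ _ hi).symm
    have h2 : Set.BijOn (I'.piecewise σ τ) (I \ I' : Finset ι) (J \ J' : Finset ι) :=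
      hτ.congr fun i hi => (Finset.piecewise_eq_of_notMem _ _ _ (Finset.mem_sdiff.1 hi).2).symm
    have h3 := h1.union h2 <| (Set.injOn_union
      (Finset.disjoint_coe.2 Finset.disjoint_sdiff)).2 ⟨h1.injOn, h2.injOn, fun i hi k hk hik =>
        (Finset.mem_sdiff.1 (h2.mapsTo hk)).2 (hik ▸ h1.mapsTo hi)⟩
    rwa [← Finset.coe_union, ← Finset.coe_union, Finset.union_sdiff_of_subset hI',
      Finset.union_sdiff_of_subset hJ'] at h3
  · by_cases hiI : i ∈ I'
    · rw [Finset.piecewise_eq_of_mem _ _ _ hiI]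
      exact hσe i hiI
    · rw [Finset.piecewise_eq_of_notMem _ _ _ hiI]
      exact hτe i (Finset.mem_sdiff.2 ⟨hi, hiI⟩)

end FamSpan

/-- The Kruskal rank is at most the size of the family, and all subfamilies of at most that size
are linearly independent. -/
theorem famKruskalRank_spec {E : Type*} [AddCommGroup E] [Module ℝ E] {m : ℕ} (v : Fin m → E) :
    famKruskalRank v ≤ m ∧ ∀ S : Finset (Fin m), S.card ≤ famKruskalRank v →
      LinearIndepOn ℝ v (S : Set (Fin m)) := by
  have hmem : famKruskalRank v ∈ {k : ℕ | k ≤ m ∧ ∀ I : Finset (Fin m), I.card = k →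
      LinearIndependent ℝ (fun i : I => v i)} := by
    refine Nat.sSup_mem ⟨0, Nat.zero_le _, fun I hI => ?_⟩ ⟨m, fun k hk => hk.1⟩
    rw [Finset.card_eq_zero] at hI
    subst hI
    exact linearIndependent_empty_type
  refine ⟨hmem.1, fun S hS => ?_⟩
  obtain ⟨T, hST, hT⟩ := Finset.exists_superset_card_eq hS (by simpa using hmem.1)
  exact LinearIndepOn.mono (s := (T : Set (Fin m))) (hmem.2 T hT) (by exact_mod_cast hST)

/-- **Kruskal's theorem in (real Hilbert) tensor products.** If the Kruskal ranks of the
three factor families sum to at least `2m + 2`, then the CP decomposition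
`∑ k, x k ⊗ y k ⊗ z k` is unique up to permutation and rescaling. -/
theorem kruskal_uniqueness_tensor {H₁ H₂ H₃ : Type*}
    [NormedAddCommGroup H₁] [InnerProductSpace ℝ H₁] [CompleteSpace H₁]
    [NormedAddCommGroup H₂] [InnerProductSpace ℝ H₂] [CompleteSpace H₂]
    [NormedAddCommGroup H₃] [InnerProductSpace ℝ H₃] [CompleteSpace H₃]
    {m : ℕ} (x a : Fin m → H₁) (y b : Fin m → H₂) (z c : Fin m → H₃)
    (hrank : 2 * m + 2 ≤ famKruskalRank x + famKruskalRank y + famKruskalRank z)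
    (heq : ∑ k, x k ⊗ₜ[ℝ] (y k ⊗ₜ[ℝ] z k) = ∑ k, a k ⊗ₜ[ℝ] (b k ⊗ₜ[ℝ] c k)) :
    ∃ (σ : Equiv.Perm (Fin m)) (Dx Dy Dz : Fin m → ℝ),
      ∀ k : Fin m, Dx k * Dy k * Dz k = 1 ∧
        a (σ k) = Dx k • x k ∧ b (σ k) = Dy k • y k ∧ c (σ k) = Dz k • z k := by
  obtain ⟨hpx, hx⟩ := famKruskalRank_spec x
  obtain ⟨hpy, hy⟩ := famKruskalRank_spec y
  obtain ⟨hpz, hz⟩ := famKruskalRank_spec z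
  obtain ⟨σ, hσ, he⟩ := exists_bijOn_of_sum_tmul_eq hpx hpy hpz hrank hx hy hz
    Finset.univ Finset.univ (by simp) le_rfl heq
  have hbij : Function.Bijective σ := by simpa [Set.bijOn_univ] using hσ
  have hscale : ∀ k, ∃ d : ℝ × ℝ × ℝ, d.1 * d.2.1 * d.2.2 = 1 ∧
      a (σ k) = d.1 • x k ∧ b (σ k) = d.2.1 • y k ∧ c (σ k) = d.2.2 • z k := by
    intro k
    have hxk : x k ≠ 0 := (hx {k} (by simp; omega)).ne_zero (by simp)
    have hyk : y k ≠ 0 := (hy {k} (by simp; omega)).ne_zero (by simp)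
    have hzk : z k ≠ 0 := (hz {k} (by simp; omega)).ne_zero (by simp)
    obtain ⟨s, hs, ha, hbc⟩ := exists_smul_eq_of_tmul_eq_tmul hxk
      (tmul_ne_zero_of_ne_zero hyk hzk) (he k (Finset.mem_univ k))
    have hbc' : (s⁻¹ • y k) ⊗ₜ[ℝ] z k = b (σ k) ⊗ₜ[ℝ] c (σ k) := by
      rw [hbc, TensorProduct.smul_tmul']
    obtain ⟨t, ht, hb, hc⟩ := exists_smul_eq_of_tmul_eq_tmul
      (smul_ne_zero (inv_ne_zero hs) hyk) hzk hbc'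
    refine ⟨(s, t * s⁻¹, t⁻¹), ?_, ha, by rw [hb, mul_smul], hc⟩
    field_simp
  choose d hd using hscale
  exact ⟨Equiv.ofBijective σ hbij, fun k => (d k).1, fun k => (d k).2.1, fun k => (d k).2.2, hd⟩
end

section
/- Let m ≥ 2, d ≥ 2m − 1, C ≥ 1, 0 ≤ μ < 1 and ζ > 0. Let f = ∑_{k=1}^m π_k ∏_{j=1}^d f_{kj}(x_j) be a probability density on [0,1]^d, where each f_{kj} is a probability density on [0,1] with ‖f_{kj}‖_∞ ≤ C, for each j the family {f_{kj}}_{k=1}^m is μ-incoherent in L²([0,1]), each π_k > 0 with ∑_k π_k = 1 and min_k π_k ≥ ζ. Let f̃ = ∑_{k=1}^m π̃_k ∏_{j=1}^d f̃_{kj}(x_j) be of the same form with probability weights π̃ ∈ Δ^{m−1} and probability densities f̃_{kj} on [0,1] satisfying ‖f̃_{kj}‖_∞ ≤ C. Set L_m = 4 m^{3/2} (m−1)!. If ‖f − f̃‖_{L²([0,1]^d)} ≤ ε with ε < (1−μ)^{2m−1} ζ² / (32 m^{5/2} L_m² C^{2m}), then there exists a permutation σ of {1,…,m} such that for all k ∈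 {1,…,m} and j ∈ {1,…,d}: ‖f_{kj} − f̃_{σ(k)j}‖_{L²([0,1])} ≤ 8 C² L_m ε / ((1−μ)^{m−1} ζ), and moreover (∑_{k=1}^m (π_k − π̃_{σ(k)})²)^{1/2} ≤ 16 C^{2m−2} L_m² ε / ((1−μ)^{3(m−1)/2} ζ). -/
open MeasureTheory

/-- The `L²` norm of a function over the unit interval. -/
noncomputable def l2normI (g : ℝ → ℝ) : ℝ :=
  Real.sqrt (∫ x in Set.Icc (0 : ℝ) 1, g x ^ 2)

/-- The unit cube `[0,1]^d`. -/
def unitCube (d : ℕ) : Set (Fin d → ℝ) :=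
  Set.univ.pi fun _ => Set.Icc (0 : ℝ) 1

/-- The `L²` norm of a function over the unit cube `[0,1]^d`. -/
noncomputable def l2normCube {d : ℕ} (g : (Fin d → ℝ) → ℝ) : ℝ :=
  Real.sqrt (∫ x in unitCube d, g x ^ 2)

/-- The constant `L_m = 4 m^{3/2} (m−1)!`. -/
noncomputable def Lconst (m : ℕ) : ℝ :=
  4 * (m : ℝ) ^ ((3 : ℝ) / 2) * (Nat.factorial (m - 1) : ℝ)

section Hilbert

variable {H : Type*} [NormedAddCommGroup H] [InnerProductSpace ℝ H]

open scoped RealInnerProductSpace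

/-- Two incoherent vectors of norm at least one are separated by a functional of controlled norm. -/
lemma exists_inner_eq_one_and_inner_eq_zero {x z : H} {μ n : ℝ} (hx : 1 ≤ ‖x‖) (hz : 1 ≤ ‖z‖)
    (hμ0 : 0 ≤ μ) (hμ1 : μ < 1) (hn0 : 0 ≤ n) (hn : 1 ≤ n ^ 2 * (1 - μ))
    (hxz : |⟪x, z⟫| ≤ μ * ‖x‖ * ‖z‖) :
    ∃ u : H, ⟪x, u⟫ = 1 ∧ ⟪z, u⟫ = 0 ∧ ‖u‖ ≤ n := by
  have hz2 : 0 < ‖z‖ ^ 2 := by positivity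
  set c : ℝ := ⟪x, z⟫ / ‖z‖ ^ 2 with hc
  set w : H := x - c • z with hw
  have hcz : c * ‖z‖ ^ 2 = ⟪x, z⟫ := by rw [hc]; field_simp
  have hzw : ⟪z, w⟫ = 0 := by
    rw [hw, inner_sub_right, inner_smul_right, real_inner_self_eq_norm_sq, hcz, real_inner_comm,
      sub_self]
  have hxw : ⟪x, w⟫ = ‖w‖ ^ 2 := by
    rw [← real_inner_self_eq_norm_sq w]
    nth_rewrite 2 [hw]
    rw [inner_sub_left, inner_smul_left, hzw]
    simp
  have hwsq : ‖w‖ ^ 2 = ‖x‖ ^ 2 - c * ⟪x, z⟫ := by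
    rw [← hxw, hw, inner_sub_right, inner_smul_right, real_inner_self_eq_norm_sq]
  have hle : c * ⟪x, z⟫ ≤ μ ^ 2 * ‖x‖ ^ 2 := by
    have h1 : ⟪x, z⟫ ^ 2 ≤ (μ * ‖x‖ * ‖z‖) ^ 2 := sq_le_sq' (abs_le.1 hxz).1 (abs_le.1 hxz).2
    rw [hc, div_mul_eq_mul_div, div_le_iff₀ hz2]
    nlinarith
  have hwge : 1 - μ ≤ ‖w‖ ^ 2 := by
    rw [hwsq]
    have hx2 : 1 ≤ ‖x‖ ^ 2 := by nlinarith
    have : μ ^ 2 ≤ μ := by nlinarith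
    nlinarith
  have hw0 : 0 < ‖w‖ ^ 2 := by linarith
  have hw1 : 0 < ‖w‖ := by
    rcases (norm_nonneg w).eq_or_lt with h | h
    · rw [← h] at hw0; norm_num at hw0
    · exact h
  refine ⟨(‖w‖ ^ 2)⁻¹ • w, ?_, ?_, ?_⟩
  · rw [inner_smul_right, hxw, inv_mul_cancel₀ hw0.ne']
  · rw [inner_smul_right, hzw, mul_zero]
  · have hnw : 1 ≤ n * ‖w‖ := by
      have : 1 ≤ (n * ‖w‖) ^ 2 := by
        rw [mul_pow]
        exact hn.trans (mul_le_mul_of_nonneg_left hwge (sq_nonneg n))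
      exact (one_le_sq_iff₀ (by positivity)).1 this
    rw [norm_smul, norm_inv, Real.norm_of_nonneg hw0.le, inv_mul_le_iff₀ hw0]
    nlinarith

/-- A family of vectors, one for each coordinate, is dual on `A` to the index `k` of the family `x`
when the product over `A` of the pairings with `x k'` is the Kronecker delta for a factorwise
reason. -/
structure IsDualOn {m d : ℕ} (x : Fin m → Fin d → H) (n : ℝ) (A : Finset (Fin d)) (k : Fin m)
    (u : Fin d → H) : Prop where
  inner_eq_one : ∀ i ∈ A, ⟪x k i, u i⟫ = 1
  exists_inner_eq_zero : ∀ k', k' ≠ k → ∃ i ∈ A, ⟪x k' i, u i⟫ = 0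
  norm_le : ∀ i ∈ A, ‖u i‖ ≤ n

lemma IsDualOn.prod_inner {m d : ℕ} {x : Fin m → Fin d → H} {n : ℝ} {A : Finset (Fin d)}
    {k : Fin m} {u : Fin d → H} (h : IsDualOn x n A k u) (k' : Fin m) :
    ∏ i ∈ A, ⟪x k' i, u i⟫ = if k' = k then 1 else 0 := by
  split_ifs with hk
  · subst hk
    exact Finset.prod_eq_one h.inner_eq_one
  · obtain ⟨i, hi, h0⟩ := h.exists_inner_eq_zero k' hk
    exact Finset.prod_eq_zero hi h0

lemma exists_isDualOn {m d : ℕ} {x : Fin m → Fin d → H} {n : ℝ}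
    (hsep : ∀ j, ∀ k k', k ≠ k' → ∃ u : H, ⟪x k j, u⟫ = 1 ∧ ⟪x k' j, u⟫ = 0 ∧ ‖u‖ ≤ n)
    {A : Finset (Fin d)} (hA : A.card = m - 1) (k : Fin m) :
    ∃ u, IsDualOn x n A k u := by
  have hcard : A.card = (Finset.univ.erase k).card := by
    rw [Finset.card_erase_of_mem (Finset.mem_univ k), Finset.card_univ, Fintype.card_fin, hA]
  let s : A ≃ (Finset.univ.erase k : Finset (Fin m)) := Finset.equivOfCardEq hcard
  have hs : ∀ i : A, k ≠ (s i : Fin m) := fun i => (Finset.ne_of_mem_erase (s i).2).symm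
  choose w hw1 hw0 hwn using fun i : A => hsep i k (s i) (hs i)
  refine ⟨fun i => if hi : i ∈ A then w ⟨i, hi⟩ else 0, ?_, ?_, ?_⟩
  · intro i hi
    simpa [hi] using hw1 ⟨i, hi⟩
  · intro k' hk'
    have hmem : k' ∈ Finset.univ.erase k := by simp [hk']
    refine ⟨(s.symm ⟨k', hmem⟩ : Fin d), (s.symm ⟨k', hmem⟩).2, ?_⟩
    simpa using hw0 (s.symm ⟨k', hmem⟩)
  · intro i hi
    simpa [hi] using hwn ⟨i, hi⟩

/-- For a square matrix, some nonzero row vector annihilates all columns but one. -/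
lemma exists_vecMul_eq_zero_off {ι : Type*} [Fintype ι] [DecidableEq ι] (M : Matrix ι ι ℝ) (l : ι) :
    ∃ v : ι → ℝ, v ≠ 0 ∧ ∀ l', l' ≠ l → ∑ k, v k * M k l' = 0 := by
  have hdet : (M.updateCol l 0).det = 0 :=
    Matrix.det_eq_zero_of_column_eq_zero l (by simp)
  obtain ⟨v, hv, h⟩ := Matrix.exists_vecMul_eq_zero_iff.2 hdet
  refine ⟨v, hv, fun l' hl' => ?_⟩
  have := congrFun h l'
  simpa [Matrix.vecMul, dotProduct, Matrix.updateCol_ne hl'] using this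

/-- The mixtures `∑ π k ⨂ x k j` and `∑ π' k ⨂ y k j` are `ε`-close when tested on rank-one
tensors. -/
def TensorClose {m d : ℕ} (π π' : Fin m → ℝ) (x y : Fin m → Fin d → H) (ε : ℝ) : Prop :=
  ∀ u : Fin d → H,
    |∑ k, π k * ∏ j, ⟪x k j, u j⟫ - ∑ k, π' k * ∏ j, ⟪y k j, u j⟫| ≤ ε * ∏ j, ‖u j‖

lemma prod_le_pow_card_of_nonneg {ι : Type*} (s : Finset ι) {a : ι → ℝ} {M : ℝ}
    (h0 : ∀ i ∈ s, 0 ≤ a i) (h : ∀ i ∈ s, a i ≤ M) : ∏ i ∈ s, a i ≤ M ^ s.card :=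
  (Finset.prod_le_prod h0 h).trans_eq (Finset.prod_const M)

lemma prod_eq_prod_of_eq_one_off {d : ℕ} (A : Finset (Fin d)) (F G : Fin d → ℝ)
    (hG : ∀ i, i ∉ A → G i = 1) (hF : ∀ i ∈ A, G i = F i) : ∏ i, G i = ∏ i ∈ A, F i := by
  rw [← Finset.prod_congr rfl hF]
  exact (Finset.prod_subset (Finset.subset_univ A) fun i _ hi => hG i hi).symm

lemma prod_two_blocks_eq {d : ℕ} {A B : Finset (Fin d)} {j : Fin d} (hAB : Disjoint A B)
    (hjA : j ∉ A) (hjB : j ∉ B) (F G : Fin d → ℝ) (c : ℝ) (K : Fin d → ℝ)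
    (hA : ∀ i ∈ A, K i = F i) (hB : ∀ i ∈ B, K i = G i) (hj : K j = c)
    (h1 : ∀ i, i ∉ A → i ∉ B → i ≠ j → K i = 1) :
    ∏ i, K i = (∏ i ∈ A, F i) * (∏ i ∈ B, G i) * c := by
  rw [← Finset.prod_congr rfl hA, ← Finset.prod_congr rfl hB, ← Finset.prod_union hAB, ← hj,
    mul_comm, ← Finset.prod_insert (by simp [hjA, hjB])]
  refine (Finset.prod_subset (Finset.subset_univ _) fun i _ hi => ?_).symm
  simp only [Finset.mem_insert, Finset.mem_union, not_or] at hi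
  exact h1 i hi.2.1 hi.2.2 hi.1

variable {m d : ℕ} {π π' : Fin m → ℝ} {x y : Fin m → Fin d → H} {e : H} {ε n : ℝ}

/-- Testing on two dual blocks and a vector `g` in a further coordinate `j`. -/
lemma TensorClose.two_blocks (h : TensorClose π π' x y ε) (hε : 0 ≤ ε) (he : ‖e‖ = 1)
    (hxe : ∀ k j, ⟪x k j, e⟫ = 1) (hye : ∀ k j, ⟪y k j, e⟫ = 1)
    {A B : Finset (Fin d)} (hA : A.card = m - 1) (hB : B.card = m - 1) (hAB : Disjoint A B)
    {j : Fin d} (hjA : j ∉ A) (hjB : j ∉ B) {u w : Fin d → H} {k k' : Fin m}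
    (hu : IsDualOn x n A k u) (hw : IsDualOn x n B k' w) (g : H) :
    |(if k = k' then π k * ⟪x k j, g⟫ else 0) - ∑ l, π' l * ((∏ i ∈ A, ⟪y l i, u i⟫) *
      (∏ i ∈ B, ⟪y l i, w i⟫) * ⟪y l j, g⟫)| ≤ ε * (n ^ (2 * (m - 1)) * ‖g‖) := by
  classical
  let U : Fin d → H := fun i => if i ∈ A then u i else if i ∈ B then w i else if i = j then g else e
  have hUA : ∀ i ∈ A, U i = u i := fun i hi => by simp [U, hi]
  have hUB : ∀ i ∈ B, U i = w i := fun i hi => by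
    simp [U, hi, Finset.disjoint_right.1 hAB hi]
  have hUj : U j = g := by simp [U, hjA, hjB]
  have hU1 : ∀ i, i ∉ A → i ∉ B → i ≠ j → U i = e := fun i h1 h2 h3 => by simp [U, h1, h2, h3]
  have hprod : ∀ z : Fin d → H, (∀ i, ⟪z i, e⟫ = 1) → ∏ i, ⟪z i, U i⟫ =
      (∏ i ∈ A, ⟪z i, u i⟫) * (∏ i ∈ B, ⟪z i, w i⟫) * ⟪z j, g⟫ := fun z hz =>
    prod_two_blocks_eq hAB hjA hjB _ _ _ _ (fun i hi => by rw [hUA i hi])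
      (fun i hi => by rw [hUB i hi]) (by rw [hUj]) (fun i h1 h2 h3 => by rw [hU1 i h1 h2 h3, hz])
  have hnorm : ∏ i, ‖U i‖ ≤ n ^ (2 * (m - 1)) * ‖g‖ := by
    rw [prod_two_blocks_eq hAB hjA hjB (fun i => ‖u i‖) (fun i => ‖w i‖) ‖g‖ _
      (fun i hi => by rw [hUA i hi]) (fun i hi => by rw [hUB i hi]) (by rw [hUj])
      (fun i h1 h2 h3 => by rw [hU1 i h1 h2 h3, he])]
    have h1 : ∏ i ∈ A, ‖u i‖ ≤ n ^ (m - 1) := by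
      rw [← hA]; exact prod_le_pow_card_of_nonneg A (fun i _ => norm_nonneg _) hu.norm_le
    have h2 : ∏ i ∈ B, ‖w i‖ ≤ n ^ (m - 1) := by
      rw [← hB]; exact prod_le_pow_card_of_nonneg B (fun i _ => norm_nonneg _) hw.norm_le
    rw [two_mul, pow_add]
    have := Finset.prod_nonneg (s := A) (fun i _ => norm_nonneg (u i))
    have := Finset.prod_nonneg (s := B) (fun i _ => norm_nonneg (w i))
    gcongr
    linarith
  have hsum : ∑ k₁, π k₁ * ∏ i, ⟪x k₁ i, U i⟫ = if k = k' then π k * ⟪x k j, g⟫ else 0 := by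
    simp_rw [hprod _ (hxe _), hu.prod_inner, hw.prod_inner]
    by_cases hk : k = k'
    · subst hk
      simp
    · rw [if_neg hk]
      refine Finset.sum_eq_zero fun i _ => ?_
      by_cases hi : i = k
      · simp [hi, hk]
      · simp [hi]
  have := h U
  rw [hsum] at this
  simp_rw [hprod _ (hye _)] at this
  exact this.trans (mul_le_mul_of_nonneg_left hnorm hε)

/-- Testing on one dual block. -/
lemma TensorClose.one_block (h : TensorClose π π' x y ε) (hε : 0 ≤ ε) (he : ‖e‖ = 1)
    (hxe : ∀ k j, ⟪x k j, e⟫ = 1) (hye : ∀ k j, ⟪y k j, e⟫ = 1)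
    {A : Finset (Fin d)} (hA : A.card = m - 1) {u : Fin d → H} {k : Fin m}
    (hu : IsDualOn x n A k u) :
    |π k - ∑ l, π' l * ∏ i ∈ A, ⟪y l i, u i⟫| ≤ ε * n ^ (m - 1) := by
  classical
  let U : Fin d → H := fun i => if i ∈ A then u i else e
  have hUA : ∀ i ∈ A, U i = u i := fun i hi => by simp [U, hi]
  have hU1 : ∀ i, i ∉ A → U i = e := fun i h1 => by simp [U, h1]
  have hprod : ∀ z : Fin d → H, (∀ i, ⟪z i, e⟫ = 1) → ∏ i, ⟪z i, U i⟫ = ∏ i ∈ A, ⟪z i, u i⟫ :=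
    fun z hz => prod_eq_prod_of_eq_one_off A _ _ (fun i hi => by rw [hU1 i hi, hz])
      (fun i hi => by rw [hUA i hi])
  have hnorm : ∏ i, ‖U i‖ ≤ n ^ (m - 1) := by
    rw [prod_eq_prod_of_eq_one_off A (fun i => ‖u i‖) _ (fun i hi => by rw [hU1 i hi, he])
      (fun i hi => by rw [hUA i hi]), ← hA]
    exact prod_le_pow_card_of_nonneg A (fun i _ => norm_nonneg _) hu.norm_le
  have hsum : ∑ k₁, π k₁ * ∏ i, ⟪x k₁ i, U i⟫ = π k := by
    simp_rw [hprod _ (hxe _), hu.prod_inner]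
    simp
  have := h U
  rw [hsum] at this
  simp_rw [hprod _ (hye _)] at this
  exact this.trans (mul_le_mul_of_nonneg_left hnorm hε)

/-- Every estimated component is close, in all coordinates outside a block `A`, to one and the same
true component. -/
lemma TensorClose.exists_matching_off (h : TensorClose π π' x y ε) (hε : 0 ≤ ε) (he : ‖e‖ = 1)
    (hxe : ∀ k j, ⟪x k j, e⟫ = 1) (hye : ∀ k j, ⟪y k j, e⟫ = 1) (hm : 2 ≤ m) (hd : 2 * m - 1 ≤ d)
    {C ζ : ℝ} (hC : 0 ≤ C) (hζ : 0 < ζ) (hπ : ∀ k, ζ ≤ π k) (hyC : ∀ k j, ‖y k j‖ ≤ C) (hn : 0 ≤ n)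
    (hsep : ∀ j, ∀ k k', k ≠ k' → ∃ u : H, ⟪x k j, u⟫ = 1 ∧ ⟪x k' j, u⟫ = 0 ∧ ‖u‖ ≤ n)
    {A : Finset (Fin d)} (hA : A.card = m - 1) :
    ∃ τ : Fin m → Fin m, ∀ l, ∀ j ∉ A,
      ‖x (τ l) j - y l j‖ ≤ m * (1 + C) * ε * n ^ (2 * (m - 1)) / ζ := by
  classical
  choose u hu using fun k => exists_isDualOn (k := k) hsep hA
  suffices H : ∀ l, ∃ k₀, ∀ j ∉ A,
      ‖x k₀ j - y l j‖ ≤ m * (1 + C) * ε * n ^ (2 * (m - 1)) / ζ by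
    choose τ hτ using H
    exact ⟨τ, hτ⟩
  intro l
  obtain ⟨v, hv, hvl⟩ :=
    exists_vecMul_eq_zero_off (fun k l => ∏ i ∈ A, ⟪y l i, u k i⟫ : Matrix (Fin m) (Fin m) ℝ) l
  obtain ⟨k₀, -, hk₀⟩ := Finset.exists_max_image Finset.univ (fun k => |v k|)
    ⟨l, Finset.mem_univ l⟩
  have hvk : 0 < |v k₀| := by
    obtain ⟨k, hk⟩ := Function.ne_iff.1 hv
    exact (abs_pos.2 hk).trans_le (hk₀ k (Finset.mem_univ k))
  refine ⟨k₀, fun j hj => ?_⟩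
  obtain ⟨B, hBsub, hB⟩ : ∃ B ⊆ (insert j A)ᶜ, B.card = m - 1 := by
    apply Finset.exists_subset_card_eq
    rw [Finset.card_compl, Finset.card_insert_of_notMem hj, Fintype.card_fin, hA]
    omega
  have hBmem : ∀ i ∈ B, i ≠ j ∧ i ∉ A := fun i hi => by simpa using hBsub hi
  have hjB : j ∉ B := fun hi => (hBmem j hi).1 rfl
  have hAB : Disjoint A B := Finset.disjoint_right.2 fun i hi => (hBmem i hi).2
  obtain ⟨w, hw⟩ := exists_isDualOn (k := k₀) hsep hB
  set z : H := x k₀ j - y l j with hz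
  set g : H := z - ⟪y l j, z⟫ • e with hg
  have hyg : ⟪y l j, g⟫ = 0 := by
    rw [hg, inner_sub_right, inner_smul_right, hye, mul_one, sub_self]
  have hxg : ⟪x k₀ j, g⟫ = ‖z‖ ^ 2 := by
    rw [hg, inner_sub_right, inner_smul_right, hxe, mul_one, ← inner_sub_left,
      ← real_inner_self_eq_norm_sq, hz]
  have hgn : ‖g‖ ≤ (1 + C) * ‖z‖ := by
    calc ‖g‖ ≤ ‖z‖ + ‖⟪y l j, z⟫ • e‖ := norm_sub_le _ _
      _ = ‖z‖ + |⟪y l j, z⟫| := by rw [norm_smul, he, mul_one, Real.norm_eq_abs]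
      _ ≤ ‖z‖ + C * ‖z‖ := by
        gcongr
        exact (abs_real_inner_le_norm _ _).trans (by gcongr; exact hyC l j)
      _ = _ := by ring
  have htest := fun k => h.two_blocks hε he hxe hye hA hB hAB hj hjB (hu k) hw g
  have hcancel : ∑ k, v k * ∑ l', π' l' * ((∏ i ∈ A, ⟪y l' i, u k i⟫) *
      (∏ i ∈ B, ⟪y l' i, w i⟫) * ⟪y l' j, g⟫) = 0 := by
    simp_rw [Finset.mul_sum]
    rw [Finset.sum_comm]
    refine Finset.sum_eq_zero fun l' _ => ?_
    by_cases hl : l' = l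
    · subst hl
      simp [hyg]
    · calc _ = (∑ k, v k * ∏ i ∈ A, ⟪y l' i, u k i⟫) *
            (π' l' * (∏ i ∈ B, ⟪y l' i, w i⟫) * ⟪y l' j, g⟫) := by
              rw [Finset.sum_mul]
              exact Finset.sum_congr rfl fun k _ => by ring
        _ = 0 := by rw [hvl l' hl, zero_mul]
  have hmain : |v k₀ * (π k₀ * ‖z‖ ^ 2)| ≤ m * (|v k₀| * (ε * (n ^ (2 * (m - 1)) * ‖g‖))) := by
    calc |v k₀ * (π k₀ * ‖z‖ ^ 2)|
        = |∑ k, v k * ((if k = k₀ then π k * ⟪x k j, g⟫ else 0) -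
            ∑ l', π' l' * ((∏ i ∈ A, ⟪y l' i, u k i⟫) *
              (∏ i ∈ B, ⟪y l' i, w i⟫) * ⟪y l' j, g⟫))| := by
          simp_rw [mul_sub]
          rw [Finset.sum_sub_distrib, hcancel]
          simp [hxg]
      _ ≤ ∑ k : Fin m, |v k₀| * (ε * (n ^ (2 * (m - 1)) * ‖g‖)) := by
          refine (Finset.abs_sum_le_sum_abs _ _).trans (Finset.sum_le_sum fun k _ => ?_)
          rw [abs_mul]
          exact mul_le_mul (hk₀ k (Finset.mem_univ k)) (htest k) (abs_nonneg _) (abs_nonneg _)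
      _ = _ := by simp
  have hπ0 : 0 < π k₀ := hζ.trans_le (hπ k₀)
  rw [abs_mul, abs_of_nonneg (by positivity : 0 ≤ π k₀ * ‖z‖ ^ 2), mul_left_comm (m : ℝ),
    mul_le_mul_iff_right₀ hvk] at hmain
  rw [le_div_iff₀ hζ]
  rcases (norm_nonneg z).eq_or_lt with hz0 | hz0
  · rw [← hz0, zero_mul]
    positivity
  · refine le_of_mul_le_mul_right ?_ hz0
    calc ‖z‖ * ζ * ‖z‖ = ζ * ‖z‖ ^ 2 := by ring
      _ ≤ π k₀ * ‖z‖ ^ 2 := by gcongr; exact hπ k₀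
      _ ≤ _ := hmain
      _ ≤ m * (ε * (n ^ (2 * (m - 1)) * ((1 + C) * ‖z‖))) := by gcongr
      _ = _ := by ring

/-- Every estimated component is close in all coordinates to one and the same true component. -/
lemma TensorClose.exists_matching (h : TensorClose π π' x y ε) (hε : 0 ≤ ε) (he : ‖e‖ = 1)
    (hxe : ∀ k j, ⟪x k j, e⟫ = 1) (hye : ∀ k j, ⟪y k j, e⟫ = 1) (hm : 2 ≤ m) (hd : 2 * m - 1 ≤ d)
    {C ζ : ℝ} (hC : 0 ≤ C) (hζ : 0 < ζ) (hπ : ∀ k, ζ ≤ π k) (hyC : ∀ k j, ‖y k j‖ ≤ C) (hn : 0 ≤ n)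
    (hsep : ∀ j, ∀ k k', k ≠ k' → ∃ u : H, ⟪x k j, u⟫ = 1 ∧ ⟪x k' j, u⟫ = 0 ∧ ‖u‖ ≤ n)
    (hsmall : 2 * (m * (1 + C) * ε * n ^ (2 * (m - 1)) / ζ) * n < 1) :
    ∃ τ : Fin m → Fin m, ∀ l j,
      ‖x (τ l) j - y l j‖ ≤ m * (1 + C) * ε * n ^ (2 * (m - 1)) / ζ := by
  classical
  obtain ⟨A, -, hA⟩ : ∃ A ⊆ (Finset.univ : Finset (Fin d)), A.card = m - 1 :=
    Finset.exists_subset_card_eq (by rw [Finset.card_univ, Fintype.card_fin]; omega)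
  obtain ⟨B, hBsub, hB⟩ : ∃ B ⊆ Aᶜ, B.card = m - 1 :=
    Finset.exists_subset_card_eq (by rw [Finset.card_compl, Fintype.card_fin, hA]; omega)
  obtain ⟨j₀, hj₀⟩ : ((A ∪ B)ᶜ).Nonempty := by
    rw [← Finset.card_pos, Finset.card_compl, Fintype.card_fin]
    have := Finset.card_union_le A B
    omega
  simp only [Finset.mem_compl, Finset.mem_union, not_or] at hj₀
  obtain ⟨τ, hτ⟩ := h.exists_matching_off hε he hxe hye hm hd hC hζ hπ hyC hn hsep hA
  obtain ⟨τ', hτ'⟩ := h.exists_matching_off hε he hxe hye hm hd hC hζ hπ hyC hn hsep hB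
  have hττ' : ∀ l, τ l = τ' l := by
    intro l
    by_contra hne
    obtain ⟨u, hu1, hu0, hun⟩ := hsep j₀ _ _ hne
    have h1 := hτ l j₀ hj₀.1
    have h2 := hτ' l j₀ hj₀.2
    set δ := m * (1 + C) * ε * n ^ (2 * (m - 1)) / ζ
    have h3 : ‖x (τ l) j₀ - x (τ' l) j₀‖ ≤ 2 * δ := by
      have := norm_sub_le_norm_sub_add_norm_sub (x (τ l) j₀) (y l j₀) (x (τ' l) j₀)
      rw [norm_sub_rev (y l j₀)] at this
      linarith
    have h4 : (1 : ℝ) = ⟪x (τ l) j₀ - x (τ' l) j₀, u⟫ := by rw [inner_sub_left, hu1, hu0, sub_zero]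
    have h5 := (real_inner_le_norm (x (τ l) j₀ - x (τ' l) j₀) u).trans
      (mul_le_mul h3 hun (norm_nonneg _) ((norm_nonneg _).trans h3))
    linarith
  refine ⟨τ, fun l j => ?_⟩
  by_cases hj : j ∈ A
  · rw [hττ']
    exact hτ' l j fun hjB => Finset.mem_compl.1 (hBsub hjB) hj
  · exact hτ l j hj

lemma abs_prod_sub_prod_le {ι : Type*} (s : Finset ι) (a b : ι → ℝ) {M D : ℝ}
    (ha : ∀ i ∈ s, |a i| ≤ M) (hb : ∀ i ∈ s, |b i| ≤ M) (hM : 0 ≤ M)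
    (hab : ∀ i ∈ s, |a i - b i| ≤ M * D) :
    |∏ i ∈ s, a i - ∏ i ∈ s, b i| ≤ s.card * M ^ s.card * D := by
  classical
  induction s using Finset.induction_on with
  | empty => simp
  | insert i s hi ih =>
    have hs := ih (fun j hj => ha j (Finset.mem_insert_of_mem hj))
      (fun j hj => hb j (Finset.mem_insert_of_mem hj))
      (fun j hj => hab j (Finset.mem_insert_of_mem hj))
    have hpa : |∏ j ∈ s, a j| ≤ M ^ s.card := by
      rw [Finset.abs_prod]
      exact prod_le_pow_card_of_nonneg s (fun j _ => abs_nonneg (a j)) fun j hj => ha j (Finset.mem_insert_of_mem hj)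
    have hi1 := hab i (Finset.mem_insert_self i s)
    have hi2 := hb i (Finset.mem_insert_self i s)
    rw [Finset.prod_insert hi, Finset.prod_insert hi, Finset.card_insert_of_notMem hi]
    calc |a i * ∏ j ∈ s, a j - b i * ∏ j ∈ s, b j|
        = |(a i - b i) * ∏ j ∈ s, a j + b i * (∏ j ∈ s, a j - ∏ j ∈ s, b j)| := by
          congr 1; ring
      _ ≤ |a i - b i| * |∏ j ∈ s, a j| + |b i| * |∏ j ∈ s, a j - ∏ j ∈ s, b j| := by
          rw [← abs_mul, ← abs_mul]
          exact abs_add_le _ _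
      _ ≤ (M * D) * M ^ s.card + M * (s.card * M ^ s.card * D) :=
          add_le_add (mul_le_mul hi1 hpa (abs_nonneg _) ((abs_nonneg _).trans hi1))
            (mul_le_mul hi2 hs (abs_nonneg _) hM)
      _ = _ := by push_cast; ring

/-- Perturbation of the components and weights of a mixture of rank-one tensors in a Hilbert
space. -/
theorem TensorClose.exists_perm (h : TensorClose π π' x y ε) (hε : 0 ≤ ε) (he : ‖e‖ = 1)
    (hxe : ∀ k j, ⟪x k j, e⟫ = 1) (hye : ∀ k j, ⟪y k j, e⟫ = 1) (hm : 2 ≤ m) (hd : 2 * m - 1 ≤ d)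
    {C ζ : ℝ} (hC : 1 ≤ C) (hζ : 0 < ζ) (hπ : ∀ k, ζ ≤ π k)
    (hπ' : ∀ k, 0 ≤ π' k) (hπ'sum : ∑ k, π' k = 1)
    (hxC : ∀ k j, ‖x k j‖ ≤ C) (hyC : ∀ k j, ‖y k j‖ ≤ C) (hn : 0 ≤ n)
    (hsep : ∀ j, ∀ k k', k ≠ k' → ∃ u : H, ⟪x k j, u⟫ = 1 ∧ ⟪x k' j, u⟫ = 0 ∧ ‖u‖ ≤ n)
    {δ ρ : ℝ} (hδ : δ = m * (1 + C) * ε * n ^ (2 * (m - 1)) / ζ)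
    (hρ : ρ = ε * n ^ (m - 1) + (m - 1 : ℕ) * (n * C) ^ (m - 1) * δ)
    (hsmall : 2 * δ * n < 1) (hρζ : ρ < ζ) :
    ∃ σ : Equiv.Perm (Fin m), (∀ k j, ‖x k j - y (σ k) j‖ ≤ δ) ∧ ∀ k, |π k - π' (σ k)| ≤ ρ := by
  classical
  subst hδ
  obtain ⟨τ, hτ⟩ := h.exists_matching hε he hxe hye hm hd (zero_le_one.trans hC) hζ hπ hyC hn hsep
    hsmall
  set δ := m * (1 + C) * ε * n ^ (2 * (m - 1)) / ζ
  have hδ0 : 0 ≤ δ := (norm_nonneg _).trans (hτ ⟨0, by omega⟩ ⟨0, by omega⟩)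
  obtain ⟨A, -, hA⟩ : ∃ A ⊆ (Finset.univ : Finset (Fin d)), A.card = m - 1 :=
    Finset.exists_subset_card_eq (by rw [Finset.card_univ, Fintype.card_fin]; omega)
  have hweight : ∀ k, |π k - ∑ l, π' l * (if τ l = k then 1 else 0)| ≤ ρ := by
    intro k
    obtain ⟨u, hu⟩ := exists_isDualOn (k := k) hsep hA
    have h1 := h.one_block hε he hxe hye hA hu
    have hbound : ∀ z : H, ‖z‖ ≤ C → ∀ i ∈ A, |⟪z, u i⟫| ≤ n * C := fun z hz i hi =>
      (abs_real_inner_le_norm _ _).trans ((mul_comm _ _).trans_le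
        (mul_le_mul (hu.norm_le i hi) hz (norm_nonneg _) hn))
    have h2 : ∀ l, |∏ i ∈ A, ⟪y l i, u i⟫ - (if τ l = k then 1 else 0)| ≤
        (m - 1 : ℕ) * (n * C) ^ (m - 1) * δ := by
      intro l
      rw [← hu.prod_inner (τ l), ← hA]
      refine abs_prod_sub_prod_le A _ _ (fun i hi => hbound _ (hyC l i) i hi)
        (fun i hi => hbound _ (hxC _ i) i hi) (by positivity) fun i hi => ?_
      rw [← inner_sub_left]
      refine (abs_real_inner_le_norm _ _).trans ?_
      rw [norm_sub_rev, mul_comm]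
      calc ‖u i‖ * ‖x (τ l) i - y l i‖ ≤ n * δ :=
            mul_le_mul (hu.norm_le i hi) (hτ l i) (norm_nonneg _) hn
        _ ≤ n * C * δ := by
            gcongr
            exact le_mul_of_one_le_right hn hC
    have h3 : |∑ l, π' l * ∏ i ∈ A, ⟪y l i, u i⟫ - ∑ l, π' l * (if τ l = k then 1 else 0)| ≤
        (m - 1 : ℕ) * (n * C) ^ (m - 1) * δ := by
      rw [← Finset.sum_sub_distrib]
      calc _ ≤ ∑ l, π' l * ((m - 1 : ℕ) * (n * C) ^ (m - 1) * δ) := by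
            refine (Finset.abs_sum_le_sum_abs _ _).trans (Finset.sum_le_sum fun l _ => ?_)
            rw [← mul_sub, abs_mul, abs_of_nonneg (hπ' l)]
            exact mul_le_mul_of_nonneg_left (h2 l) (hπ' l)
        _ = _ := by rw [← Finset.sum_mul, hπ'sum, one_mul]
    rw [hρ]
    exact (abs_sub_le _ _ _).trans (add_le_add h1 h3)
  have hsurj : Function.Surjective τ := by
    intro k
    by_contra! hk
    have := hweight k
    simp only [hk, if_false, mul_zero, Finset.sum_const_zero, sub_zero] at this
    linarith [le_abs_self (π k), hπ k]
  let σ : Equiv.Perm (Fin m) := Equiv.ofBijective τ (Finite.surjective_iff_bijective.1 hsurj)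
  have hσ : ∀ l, τ l = σ l := fun l => rfl
  refine ⟨σ.symm, fun k j => ?_, fun k => ?_⟩
  · have := hτ (σ.symm k) j
    rwa [hσ, Equiv.apply_symm_apply] at this
  · have := hweight k
    simp_rw [hσ, ← Equiv.eq_symm_apply] at this
    simpa using this

end Hilbert

section UnitInterval

/-- Lebesgue measure on the unit interval. -/
noncomputable abbrev unitMeasure : Measure ℝ := volume.restrict (Set.Icc (0 : ℝ) 1)

instance isProbabilityMeasure_unitMeasure : IsProbabilityMeasure unitMeasure :=
  ⟨by simp [unitMeasure]⟩

lemma restrict_unitCube (d : ℕ) :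
    (volume : Measure (Fin d → ℝ)).restrict (unitCube d) = Measure.pi fun _ => unitMeasure := by
  rw [volume_pi, unitCube, Measure.restrict_pi_pi]

lemma inner_toLp {α : Type*} [MeasurableSpace α] {ν : Measure α} {g h : α → ℝ}
    (hg : MemLp g 2 ν) (hh : MemLp h 2 ν) :
    inner ℝ (hg.toLp g) (hh.toLp h) = ∫ a, g a * h a ∂ν := by
  rw [L2.inner_def]
  refine integral_congr_ae ?_
  filter_upwards [hg.coeFn_toLp, hh.coeFn_toLp] with a h1 h2
  rw [h1, h2, real_inner_eq_re_inner]
  simp [mul_comm]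

lemma norm_toLp_eq_sqrt {α : Type*} [MeasurableSpace α] {ν : Measure α} {g : α → ℝ}
    (hg : MemLp g 2 ν) : ‖hg.toLp g‖ = Real.sqrt (∫ a, g a ^ 2 ∂ν) := by
  rw [norm_eq_sqrt_real_inner, inner_toLp]
  simp_rw [pow_two]

lemma abs_integral_mul_le {α : Type*} [MeasurableSpace α] {ν : Measure α} {g h : α → ℝ}
    (hg : MemLp g 2 ν) (hh : MemLp h 2 ν) :
    |∫ a, g a * h a ∂ν| ≤ Real.sqrt (∫ a, g a ^ 2 ∂ν) * Real.sqrt (∫ a, h a ^ 2 ∂ν) := by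
  rw [← inner_toLp hg hh, ← norm_toLp_eq_sqrt hg, ← norm_toLp_eq_sqrt hh]
  exact abs_real_inner_le_norm _ _

lemma memLp_two_prod {d : ℕ} {ν : Measure ℝ} [IsFiniteMeasure ν] {g : Fin d → ℝ → ℝ}
    (hg : ∀ j, MemLp (g j) 2 ν) :
    MemLp (fun t : Fin d → ℝ => ∏ j, g j (t j)) 2 (Measure.pi fun _ => ν) := by
  have h1 : Integrable (fun t : Fin d → ℝ => ∏ j, g j (t j)) (Measure.pi fun _ => ν) :=
    Integrable.fintype_prod fun j => (hg j).integrable one_le_two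
  rw [memLp_two_iff_integrable_sq h1.aestronglyMeasurable]
  simp_rw [← Finset.prod_pow]
  exact Integrable.fintype_prod (f := fun j s => g j s ^ 2) fun j => (hg j).integrable_sq

lemma sqrt_integral_prod_sq {d : ℕ} {ν : Measure ℝ} [IsFiniteMeasure ν] (g : Fin d → ℝ → ℝ) :
    Real.sqrt (∫ t : Fin d → ℝ, (∏ j, g j (t j)) ^ 2 ∂Measure.pi fun _ => ν) =
      ∏ j, Real.sqrt (∫ s, g j s ^ 2 ∂ν) := by
  simp_rw [← Finset.prod_pow]
  rw [integral_fintype_prod_eq_prod (fun j s => g j s ^ 2)]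
  exact Real.sqrt_prod _ fun j _ => integral_nonneg fun s => sq_nonneg _

/-- `L²`-closeness of two mixture densities, seen through their components. -/
lemma tensorClose_of_l2normCube_le {m d : ℕ} {π π' : Fin m → ℝ} {f f' : Fin m → Fin d → ℝ → ℝ}
    (hf : ∀ k j, MemLp (f k j) 2 unitMeasure) (hf' : ∀ k j, MemLp (f' k j) 2 unitMeasure) {ε : ℝ}
    (h : l2normCube (fun t : Fin d → ℝ =>
      (∑ k, π k * ∏ j, f k j (t j)) - (∑ k, π' k * ∏ j, f' k j (t j))) ≤ ε) :
    TensorClose π π' (fun k j => (hf k j).toLp (f k j)) (fun k j => (hf' k j).toLp (f' k j)) ε := by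
  intro u
  have hu : ∀ j, MemLp (u j) 2 unitMeasure := fun j => Lp.memLp (u j)
  have hinner : ∀ {g : ℝ → ℝ} (hg : MemLp g 2 unitMeasure) (j : Fin d),
      inner ℝ (hg.toLp g) (u j) = ∫ s, g s * u j s ∂unitMeasure := by
    intro g hg j
    rw [← inner_toLp hg (hu j), Lp.toLp_coeFn]
  have hnorm : ∀ j, ‖u j‖ = Real.sqrt (∫ s, u j s ^ 2 ∂unitMeasure) := by
    intro j
    rw [← norm_toLp_eq_sqrt (hu j), Lp.toLp_coeFn]
  have hmix : ∀ (p : Fin m → ℝ) {q : Fin m → Fin d → ℝ → ℝ},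
      (∀ k j, MemLp (q k j) 2 unitMeasure) →
      MemLp (fun t : Fin d → ℝ => ∑ k, p k * ∏ j, q k j (t j)) 2
        (Measure.pi fun _ => unitMeasure) := fun p q hq =>
    memLp_finsetSum _ fun k _ => (memLp_two_prod (hq k)).const_mul (p k)
  have hU := memLp_two_prod hu
  have hpair : ∀ (p : Fin m → ℝ) {q : Fin m → Fin d → ℝ → ℝ}
      (_ : ∀ k j, MemLp (q k j) 2 unitMeasure),
      ∫ t : Fin d → ℝ, (∑ k, p k * ∏ j, q k j (t j)) * ∏ j, u j (t j)
        ∂(Measure.pi fun _ => unitMeasure) =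
      ∑ k, p k * ∏ j, ∫ s, q k j s * u j s ∂unitMeasure := by
    intro p q hq
    simp_rw [Finset.sum_mul, mul_assoc]
    rw [integral_finsetSum]
    · refine Finset.sum_congr rfl fun k _ => ?_
      rw [integral_const_mul]
      simp_rw [← Finset.prod_mul_distrib]
      rw [integral_fintype_prod_eq_prod (fun j s => q k j s * u j s)]
    · intro k _
      exact ((memLp_two_prod (hq k)).integrable_mul hU).const_mul (p k)
  simp_rw [hinner, hnorm]
  rw [← hpair π hf, ← hpair π' hf']
  erw [← integral_sub ((hmix π hf).integrable_mul hU) ((hmix π' hf').integrable_mul hU)]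
  simp_rw [Pi.mul_apply, ← sub_mul]
  refine (abs_integral_mul_le ((hmix π hf).sub (hmix π' hf')) hU).trans ?_
  rw [sqrt_integral_prod_sq fun j s => u j s]
  refine mul_le_mul_of_nonneg_right ?_ (Finset.prod_nonneg fun j _ => Real.sqrt_nonneg _)
  rwa [l2normCube, restrict_unitCube] at h

lemma norm_toLp_le_of_bound {α : Type*} [MeasurableSpace α] {ν : Measure α} [IsProbabilityMeasure ν]
    {g : α → ℝ} {C : ℝ} (hC : 0 ≤ C) (hg : MemLp g 2 ν) (hb : ∀ᵐ a ∂ν, |g a| ≤ C) :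
    ‖hg.toLp g‖ ≤ C := by
  rw [norm_toLp_eq_sqrt hg]
  refine Real.sqrt_le_iff.2 ⟨hC, ?_⟩
  calc ∫ a, g a ^ 2 ∂ν ≤ ∫ _, C ^ 2 ∂ν := by
        refine integral_mono_ae hg.integrable_sq (integrable_const _) ?_
        filter_upwards [hb] with a ha
        exact sq_le_sq' (abs_le.1 ha).1 (abs_le.1 ha).2
    _ = C ^ 2 := by simp

end UnitInterval

lemma four_mul_rpow_le_Lconst (m : ℕ) : 4 * (m : ℝ) ^ ((3 : ℝ) / 2) ≤ Lconst m := by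
  have h : (1 : ℝ) ≤ (Nat.factorial (m - 1) : ℝ) := by
    exact_mod_cast Nat.one_le_iff_ne_zero.2 (Nat.factorial_ne_zero _)
  exact le_mul_of_one_le_right (by positivity) h

lemma four_mul_le_Lconst {m : ℕ} (hm : 1 ≤ m) : 4 * (m : ℝ) ≤ Lconst m := by
  refine le_trans ?_ (four_mul_rpow_le_Lconst m)
  gcongr
  simpa using Real.rpow_le_rpow_of_exponent_le (by exact_mod_cast hm : (1 : ℝ) ≤ m)
    (by norm_num : (1 : ℝ) ≤ 3 / 2)

lemma sqrt_mul_sq_le_Lconst_sq {m : ℕ} (hm : 1 ≤ m) : Real.sqrt m * m ^ 2 ≤ Lconst m ^ 2 := by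
  have hm1 : (1 : ℝ) ≤ m := by exact_mod_cast hm
  have h1 : Real.sqrt m ≤ m := Real.sqrt_le_iff.2 ⟨by positivity, by nlinarith⟩
  have h2 : ((m : ℝ) ^ ((3 : ℝ) / 2)) ^ 2 = m ^ 3 := by
    rw [← Real.rpow_natCast, ← Real.rpow_mul (by positivity), ← Real.rpow_natCast]
    norm_num
  have h3 : (m : ℝ) ^ ((3 : ℝ) / 2) ≤ Lconst m := by
    have : 0 ≤ (m : ℝ) ^ ((3 : ℝ) / 2) := by positivity
    linarith [four_mul_rpow_le_Lconst m]
  calc Real.sqrt m * m ^ 2 ≤ m * m ^ 2 := by gcongr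
    _ = ((m : ℝ) ^ ((3 : ℝ) / 2)) ^ 2 := by rw [h2]; ring
    _ ≤ _ := by gcongr

/-- The smallness threshold and the sizes of the perturbation bounds. -/
lemma perturbation_constants {m : ℕ} (hm : 2 ≤ m) {C ν ζ ε n δ ρ : ℝ} (hC : 1 ≤ C) (hν0 : 0 < ν)
    (hν1 : ν ≤ 1) (hζ : 0 < ζ) (hζ1 : ζ ≤ 1) (hε : 0 ≤ ε) (hn : n = ν ^ (-(1 / 2) : ℝ))
    (hδ : δ = m * (1 + C) * ε * n ^ (2 * (m - 1)) / ζ)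
    (hρ : ρ = ε * n ^ (m - 1) + (m - 1 : ℕ) * (n * C) ^ (m - 1) * δ)
    (hεsmall : ε < ν ^ (2 * m - 1) * ζ ^ 2 /
        (32 * (m : ℝ) ^ ((5 : ℝ) / 2) * Lconst m ^ 2 * C ^ (2 * m))) :
    2 * δ * n < 1 ∧ ρ < ζ ∧ δ ≤ 8 * C ^ 2 * Lconst m / (ν ^ (m - 1) * ζ) * ε ∧
      Real.sqrt m * ρ ≤ 16 * C ^ (2 * m - 2) * Lconst m ^ 2 /
          (ν ^ ((3 * ((m : ℝ) - 1)) / 2) * ζ) * ε := by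
  have hm1 : (1 : ℝ) ≤ m := by exact_mod_cast (by omega : 1 ≤ m)
  have hm0 : (0 : ℝ) < m := by linarith
  have hC0 : 0 < C := by linarith
  have hn1 : 1 ≤ n := by
    rw [hn]
    exact Real.one_le_rpow_of_pos_of_le_one_of_nonpos hν0 hν1 (by norm_num)
  have hn0 : 0 < n := by linarith
  have hnν : n ^ 2 * ν = 1 := by
    rw [hn, ← Real.rpow_natCast, ← Real.rpow_mul hν0.le]
    norm_num
    rw [Real.rpow_neg_one, inv_mul_cancel₀ hν0.ne']
  have hL : 4 * (m : ℝ) ≤ Lconst m := four_mul_le_Lconst (by omega)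
  have hL0 : 0 < Lconst m := by linarith
  have h52' : (m : ℝ) ≤ (m : ℝ) ^ ((5 : ℝ) / 2) := by
    simpa using Real.rpow_le_rpow_of_exponent_le hm1 (by norm_num : (1 : ℝ) ≤ 5 / 2)
  have hpow : n ^ (2 * (m - 1)) * ν ^ (m - 1) = 1 := by
    rw [pow_mul, ← mul_pow, hnν, one_pow]
  have hpow' : n ^ (2 * (2 * m - 1)) * ν ^ (2 * m - 1) = 1 := by
    rw [pow_mul, ← mul_pow, hnν, one_pow]
  have hn3 : n ^ (3 * (m - 1)) * ν ^ ((3 * ((m : ℝ) - 1)) / 2) = 1 := by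
    rw [hn, ← Real.rpow_natCast, ← Real.rpow_mul hν0.le, ← Real.rpow_add hν0]
    rw [show -(1 / 2) * ((3 * (m - 1) : ℕ) : ℝ) + 3 * ((m : ℝ) - 1) / 2 = 0 by
      push_cast [Nat.cast_sub (by omega : 1 ≤ m)]; ring, Real.rpow_zero]
  have hδ0 : 0 ≤ δ := by rw [hδ]; positivity
  have hδle : δ ≤ 2 * m * C * ε * n ^ (2 * (m - 1)) / ζ := by
    rw [hδ]
    gcongr ?_ * ε * _ / ζ
    nlinarith
  have hmsub : ((m - 1 : ℕ) : ℝ) = m - 1 := by push_cast [Nat.cast_sub (by omega : 1 ≤ m)]; ring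
  have hCm : C ^ m ≤ C ^ (2 * m - 2) := pow_le_pow_right₀ hC (by omega)
  have hCm' : C ^ (2 * m - 2) ≤ C ^ (2 * m) := pow_le_pow_right₀ hC (by omega)
  have hρle : ρ ≤ 2 * m ^ 2 * C ^ (2 * m - 2) * n ^ (3 * (m - 1)) / ζ * ε := by
    have h1 : ε * n ^ (m - 1) ≤ C ^ (2 * m - 2) * n ^ (3 * (m - 1)) / ζ * ε := by
      rw [mul_comm]
      gcongr
      rw [le_div_iff₀ hζ]
      have a1 : n ^ (m - 1) ≤ n ^ (3 * (m - 1)) := pow_le_pow_right₀ hn1 (by omega)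
      have a2 : 1 ≤ C ^ (2 * m - 2) := one_le_pow₀ hC
      calc n ^ (m - 1) * ζ ≤ n ^ (3 * (m - 1)) * 1 := by gcongr
        _ ≤ _ := by rw [mul_comm]; gcongr
    have h2 : (m - 1 : ℕ) * (n * C) ^ (m - 1) * δ ≤
        2 * (m - 1) * m * C ^ (2 * m - 2) * n ^ (3 * (m - 1)) / ζ * ε := by
      rw [hmsub]
      have a0 : (0 : ℝ) ≤ m - 1 := by linarith
      calc _ ≤ ((m : ℝ) - 1) * (n * C) ^ (m - 1) * (2 * m * C * ε * n ^ (2 * (m - 1)) / ζ) := by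
            gcongr
        _ = 2 * (m - 1) * m * (C ^ (m - 1) * C) * (n ^ (m - 1) * n ^ (2 * (m - 1))) / ζ * ε := by
            rw [mul_pow]; ring
        _ = 2 * (m - 1) * m * C ^ m * n ^ (3 * (m - 1)) / ζ * ε := by
            rw [← pow_succ, ← pow_add, show m - 1 + 1 = m by omega,
              show m - 1 + 2 * (m - 1) = 3 * (m - 1) by omega]
        _ ≤ _ := by gcongr
    set T := C ^ (2 * m - 2) * n ^ (3 * (m - 1)) / ζ * ε with hT
    have hT0 : 0 ≤ T := by positivity
    calc ρ ≤ T + 2 * (m - 1) * m * T := by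
          rw [hρ]
          refine add_le_add h1 (h2.trans_eq ?_)
          rw [hT]; ring
      _ ≤ 2 * m ^ 2 * T := by nlinarith
      _ = _ := by rw [hT]; ring
  have hεle : ε * (32 * m ^ 3 * C ^ (2 * m) * n ^ (2 * (2 * m - 1))) < ζ ^ 2 := by
    rw [lt_div_iff₀ (by positivity)] at hεsmall
    have hL2 : (m : ℝ) ^ 2 ≤ Lconst m ^ 2 := by gcongr; linarith
    calc ε * (32 * m ^ 3 * C ^ (2 * m) * n ^ (2 * (2 * m - 1)))
        = ε * (32 * m * m ^ 2 * C ^ (2 * m)) * n ^ (2 * (2 * m - 1)) := by ring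
      _ ≤ ε * (32 * (m : ℝ) ^ ((5 : ℝ) / 2) * Lconst m ^ 2 * C ^ (2 * m)) *
            n ^ (2 * (2 * m - 1)) := by gcongr
      _ < ν ^ (2 * m - 1) * ζ ^ 2 * n ^ (2 * (2 * m - 1)) := by gcongr
      _ = n ^ (2 * (2 * m - 1)) * ν ^ (2 * m - 1) * ζ ^ 2 := by ring
      _ = ζ ^ 2 := by rw [hpow', one_mul]
  have hmm : (m : ℝ) ≤ m ^ 3 := le_self_pow₀ hm1 (by norm_num)
  refine ⟨?_, ?_, ?_, ?_⟩
  · calc 2 * δ * n ≤ 2 * (2 * m * C * ε * n ^ (2 * (m - 1)) / ζ) * n := by gcongr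
      _ = ε * (4 * m * C ^ 1 * n ^ (2 * (m - 1) + 1)) / ζ := by rw [pow_succ]; ring
      _ ≤ ε * (32 * m ^ 3 * C ^ (2 * m) * n ^ (2 * (2 * m - 1))) / ζ := by
          gcongr
          · norm_num
          · omega
          · omega
      _ < 1 := by
          rw [div_lt_one hζ]
          nlinarith
  · refine hρle.trans_lt ?_
    have hnpow : n ^ (3 * (m - 1)) ≤ n ^ (2 * (2 * m - 1)) := pow_le_pow_right₀ hn1 (by omega)
    calc 2 * m ^ 2 * C ^ (2 * m - 2) * n ^ (3 * (m - 1)) / ζ * ε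
        = ε * (2 * m ^ 2 * C ^ (2 * m - 2) * n ^ (3 * (m - 1))) / ζ := by ring
      _ ≤ ε * (32 * m ^ 3 * C ^ (2 * m) * n ^ (2 * (2 * m - 1))) / ζ := by
          gcongr <;> norm_num
      _ < ζ := by
          rw [div_lt_iff₀ hζ, ← pow_two]
          exact hεle
  · have hinv : n ^ (2 * (m - 1)) = 1 / ν ^ (m - 1) := eq_one_div_of_mul_eq_one_left hpow
    calc δ ≤ 2 * m * C * ε * n ^ (2 * (m - 1)) / ζ := hδle
      _ = 2 * C * m / (ν ^ (m - 1) * ζ) * ε := by rw [hinv]; field_simp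
      _ ≤ _ := by
          gcongr
          · norm_num
          · exact le_self_pow₀ hC (by norm_num)
          · linarith
  · have hinv : n ^ (3 * (m - 1)) = 1 / ν ^ ((3 * ((m : ℝ) - 1)) / 2) :=
      eq_one_div_of_mul_eq_one_left hn3
    have hνp : 0 < ν ^ ((3 * ((m : ℝ) - 1)) / 2) := Real.rpow_pos_of_pos hν0 _
    have hs := sqrt_mul_sq_le_Lconst_sq (show 1 ≤ m by omega)
    calc Real.sqrt m * ρ
        ≤ Real.sqrt m * (2 * m ^ 2 * C ^ (2 * m - 2) * n ^ (3 * (m - 1)) / ζ * ε) := by gcongr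
      _ = 2 * C ^ (2 * m - 2) * (Real.sqrt m * m ^ 2) /
            (ν ^ ((3 * ((m : ℝ) - 1)) / 2) * ζ) * ε := by rw [hinv]; field_simp
      _ ≤ _ := by
          gcongr
          norm_num

/-- **Perturbation theorem for components (Theorem 3.5).** If a proper estimator `f̃` of a
`(μ,ζ)`-estimable mixture density `f` is `ε`-close in `L²` and `ε` is small enough, then up
to a permutation every estimated component density and the mixing weights are `O(ε)`-close
to the truth. -/
theorem component_perturbation {m d : ℕ} (hm : 2 ≤ m) (hd : 2 * m - 1 ≤ d)
    (C μ ζ ε : ℝ) (hC : 1 ≤ C) (hμ0 : 0 ≤ μ) (hμ1 : μ < 1) (hζ : 0 < ζ)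
    (π π' : Fin m → ℝ) (f f' : Fin m → Fin d → ℝ → ℝ)
    -- `f` is a `(μ,ζ)`-estimable mixture density:
    (hπpos : ∀ k, 0 < π k) (hπsum : ∑ k, π k = 1) (hπζ : ∀ k, ζ ≤ π k)
    (hmeas : ∀ k j, Measurable (f k j))
    (hnn : ∀ k j, ∀ x ∈ Set.Icc (0 : ℝ) 1, 0 ≤ f k j x)
    (hint : ∀ k j, (∫ x in Set.Icc (0 : ℝ) 1, f k j x) = 1)
    (hbdd : ∀ k j, ∀ᵐ x ∂(volume.restrict (Set.Icc (0 : ℝ) 1)), |f k j x| ≤ C)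
    (hincoh : ∀ j, ∀ k k' : Fin m, k ≠ k' →
      |∫ x in Set.Icc (0 : ℝ) 1, f k j x * f k' j x| ≤ μ * l2normI (f k j) * l2normI (f k' j))
    -- `f'` is a proper estimator (same mixture structure):
    (hπ'nn : ∀ k, 0 ≤ π' k) (hπ'sum : ∑ k, π' k = 1)
    (hmeas' : ∀ k j, Measurable (f' k j))
    (hnn' : ∀ k j, ∀ x ∈ Set.Icc (0 : ℝ) 1, 0 ≤ f' k j x)
    (hint' : ∀ k j, (∫ x in Set.Icc (0 : ℝ) 1, f' k j x) = 1)
    (hbdd' : ∀ k j, ∀ᵐ x ∂(volume.restrict (Set.Icc (0 : ℝ) 1)), |f' k j x| ≤ C)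
    -- closeness of the joint densities and smallness of `ε`:
    (hclose : l2normCube (fun x : Fin d → ℝ =>
        (∑ k, π k * ∏ j, f k j (x j)) - (∑ k, π' k * ∏ j, f' k j (x j))) ≤ ε)
    (hεsmall : ε < (1 - μ) ^ (2 * m - 1) * ζ ^ 2 /
        (32 * (m : ℝ) ^ ((5 : ℝ) / 2) * Lconst m ^ 2 * C ^ (2 * m))) :
    ∃ σ : Equiv.Perm (Fin m),
      (∀ k j, l2normI (fun x => f k j x - f' (σ k) j x) ≤
          8 * C ^ 2 * Lconst m / ((1 - μ) ^ (m - 1) * ζ) * ε) ∧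
      Real.sqrt (∑ k, (π k - π' (σ k)) ^ 2) ≤
        16 * C ^ (2 * m - 2) * Lconst m ^ 2 /
          ((1 - μ) ^ ((3 * ((m : ℝ) - 1)) / 2) * ζ) * ε := by
  have hε : 0 ≤ ε := (Real.sqrt_nonneg _).trans hclose
  have hν0 : 0 < 1 - μ := by linarith
  have hC0 : 0 ≤ C := zero_le_one.trans hC
  have hζ1 : ζ ≤ 1 := by
    let k₀ : Fin m := ⟨0, by omega⟩
    refine (hπζ k₀).trans (hπsum ▸ ?_)
    exact Finset.single_le_sum (fun k _ => (hπpos k).le) (Finset.mem_univ k₀)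
  have hf : ∀ k j, MemLp (f k j) 2 unitMeasure := fun k j =>
    MemLp.of_bound (hmeas k j).aestronglyMeasurable C (hbdd k j)
  have hf' : ∀ k j, MemLp (f' k j) 2 unitMeasure := fun k j =>
    MemLp.of_bound (hmeas' k j).aestronglyMeasurable C (hbdd' k j)
  have h1 : MemLp (fun _ : ℝ => (1 : ℝ)) 2 unitMeasure := memLp_const 1
  have he : ‖h1.toLp _‖ = 1 := by rw [norm_toLp_eq_sqrt]; simp
  have hone : ∀ {g : ℝ → ℝ} (hg : MemLp g 2 unitMeasure), ∫ s, g s ∂unitMeasure = 1 →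
      inner ℝ (hg.toLp g) (h1.toLp _) = 1 := by
    intro g hg hg1
    rw [inner_toLp]
    simpa using hg1
  have hge : ∀ k j, 1 ≤ ‖(hf k j).toLp (f k j)‖ := by
    intro k j
    have := real_inner_le_norm ((hf k j).toLp (f k j)) (h1.toLp _)
    rwa [hone _ (hint k j), he, mul_one] at this
  obtain ⟨hδn, hρζ, hδle, hρle⟩ :=
    perturbation_constants hm hC hν0 (by linarith) hζ hζ1 hε rfl rfl rfl hεsmall
  set n : ℝ := (1 - μ) ^ (-(1 / 2) : ℝ) with hn
  have hn0 : 0 ≤ n := Real.rpow_nonneg hν0.le _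
  have hnν : 1 ≤ n ^ 2 * (1 - μ) := by
    rw [hn, ← Real.rpow_natCast, ← Real.rpow_mul hν0.le]
    norm_num
    rw [Real.rpow_neg_one, inv_mul_cancel₀ hν0.ne']
  have hsep : ∀ j, ∀ k k', k ≠ k' → ∃ u : Lp ℝ 2 unitMeasure,
      inner ℝ ((hf k j).toLp (f k j)) u = 1 ∧ inner ℝ ((hf k' j).toLp (f k' j)) u = 0 ∧
        ‖u‖ ≤ n := by
    intro j k k' hk
    refine exists_inner_eq_one_and_inner_eq_zero (hge k j) (hge k' j) hμ0 hμ1 hn0 hnν ?_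
    rw [inner_toLp, norm_toLp_eq_sqrt, norm_toLp_eq_sqrt]
    exact hincoh j k k' hk
  obtain ⟨σ, hσ, hσπ⟩ := (tensorClose_of_l2normCube_le hf hf' hclose).exists_perm hε he
    (fun k j => hone _ (hint k j)) (fun k j => hone _ (hint' k j)) hm hd hC hζ hπζ hπ'nn hπ'sum
    (fun k j => norm_toLp_le_of_bound hC0 _ (hbdd k j))
    (fun k j => norm_toLp_le_of_bound hC0 _ (hbdd' k j)) hn0 hsep rfl rfl hδn hρζ
  refine ⟨σ, fun k j => ?_, ?_⟩
  · have := (hσ k j).trans hδle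
    rwa [← MemLp.toLp_sub, norm_toLp_eq_sqrt] at this
  · refine le_trans ?_ hρle
    set ρ := ε * n ^ (m - 1) + (m - 1 : ℕ) * (n * C) ^ (m - 1) *
      (m * (1 + C) * ε * n ^ (2 * (m - 1)) / ζ)
    have hρ0 : 0 ≤ ρ := (abs_nonneg _).trans (hσπ ⟨0, by omega⟩)
    rw [← Real.sqrt_sq hρ0, ← Real.sqrt_mul (Nat.cast_nonneg m)]
    refine Real.sqrt_le_sqrt ?_
    calc ∑ k, (π k - π' (σ k)) ^ 2 ≤ ∑ _k : Fin m, ρ ^ 2 :=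
          Finset.sum_le_sum fun k _ => sq_le_sq' (abs_le.1 (hσπ k)).1 (abs_le.1 (hσπ k)).2
      _ = m * ρ ^ 2 := by simp
end
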